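/- arXiv:1609.08204 — 4 statements merged into one kernel-verified Lean document; each statement's English description precedes it below -/
import Mathlib

section
/- Let β ≠ 0, α ∈ ℝ, c ≥ 0, and suppose there exists a CIUPM for T_{α,β} whose support has diameter equal to c. Then for every c̃ > c there exists a CIUPM for T_{α,β} whose support has diameter equal to c̃. -/
open MeasureTheory Set

/-- The linear transformation `T_{α,β}(x) = βx + α`. -/
def T (α β : ℝ) : ℝ → ℝ := fun x => β * x + α

/-- A probability measure `μ` on `ℝ` is a CIUPM for a map `S : ℝ → ℝ` if the pushforwards
of `μ` and of `μ ∘ S⁻¹` under the fractional-part map both equal Lebesgue measure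
restricted to `[0,1)`. -/
def IsCIUPM (S : ℝ → ℝ) (μ : Measure ℝ) : Prop :=
  μ.map Int.fract = volume.restrict (Ico (0 : ℝ) 1) ∧
    (μ.map S).map Int.fract = volume.restrict (Ico (0 : ℝ) 1)

/-- The topological support of a measure on `ℝ`: the set of points all of whose
neighbourhoods have positive measure (the smallest closed set of full measure). -/
def msupp (μ : Measure ℝ) : Set ℝ := {x : ℝ | ∀ U ∈ nhds x, 0 < μ U}

/-- Rotations modulo one preserve Lebesgue measure on `[0,1)`. -/
theorem map_fract_add_restrict_Ico (d : ℝ) :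
    (volume.restrict (Ico (0 : ℝ) 1)).map (fun x => Int.fract (x + d)) =
      volume.restrict (Ico (0 : ℝ) 1) := by
  have hm : Measurable fun x : ℝ => Int.fract (x + d) := by fun_prop
  ext E hE
  rw [Measure.map_apply hm hE, Measure.restrict_apply (hm hE), Measure.restrict_apply hE,
    measure_congr ((ae_eq_refl _).inter Ico_ae_eq_Ioc)]
  have key := (isAddFundamentalDomain_Ioc (one_pos : (0 : ℝ) < 1) 0).measure_set_eq
    (isAddFundamentalDomain_Ioc (one_pos : (0 : ℝ) < 1) (-d)) (hm hE) (fun g => by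
      obtain ⟨_, n, rfl⟩ := g
      ext x
      have hx : (n : ℝ) + x + d = x + d + n := by ring
      simp [AddSubgroup.vadd_def, hx])
  rw [zero_add] at key
  have hpre : (fun x => Int.fract (x + d)) ⁻¹' E ∩ Ioc (-d) (-d + 1) =
      (fun x => x + d) ⁻¹' (Int.fract ⁻¹' E ∩ Ioc 0 1) := by
    ext x
    simp only [mem_inter_iff, mem_preimage, mem_Ioc]
    constructor <;> rintro ⟨h₁, h₂, h₃⟩ <;> exact ⟨h₁, by linarith, by linarith⟩
  rw [key, hpre, measure_preimage_add_right,
    measure_congr ((ae_eq_refl _).inter Ico_ae_eq_Ioc.symm)]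
  congr 1
  ext x
  simp only [mem_inter_iff, mem_preimage]
  refine and_congr_left fun hx => ?_
  rw [Int.fract_eq_self.2 hx]

/-- Translating a measure which is uniform modulo one keeps it uniform modulo one. -/
theorem map_add_map_fract {μ : Measure ℝ}
    (h : μ.map Int.fract = volume.restrict (Ico (0 : ℝ) 1)) (d : ℝ) :
    (μ.map (fun x => x + d)).map Int.fract = volume.restrict (Ico (0 : ℝ) 1) := by
  rw [← map_fract_add_restrict_Ico d, ← h, Measure.map_map (by fun_prop) (by fun_prop),
    Measure.map_map (by fun_prop) (by fun_prop)]
  congr 1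
  ext x
  have : x + d = Int.fract x + d + (⌊x⌋ : ℤ) := by rw [Int.fract]; ring
  simp only [Function.comp_apply]
  rw [this, Int.fract_add_intCast]

theorem measurable_T (α β : ℝ) : Measurable (T α β) := by
  unfold T
  fun_prop

theorem IsCIUPM.map_add {α β : ℝ} {μ : Measure ℝ} (h : IsCIUPM (T α β) μ) (d : ℝ) :
    IsCIUPM (T α β) (μ.map (fun x => x + d)) := by
  refine ⟨map_add_map_fract h.1 d, ?_⟩
  rw [← map_add_map_fract h.2 (β * d), Measure.map_map (measurable_T α β) (by fun_prop),
    Measure.map_map (by fun_prop) (measurable_T α β)]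
  congr 2
  ext x
  simp only [Function.comp_apply, T]
  ring

/-- The midpoint of two CIUPMs is a CIUPM. -/
theorem IsCIUPM.half_add {S : ℝ → ℝ} (hS : Measurable S) {μ ν : Measure ℝ}
    (hμ : IsCIUPM S μ) (hν : IsCIUPM S ν) : IsCIUPM S ((2⁻¹ : ENNReal) • (μ + ν)) := by
  have hf : Measurable (Int.fract : ℝ → ℝ) := measurable_fract
  constructor
  · rw [Measure.map_smul, Measure.map_add _ _ hf, hμ.1, hν.1, ← two_smul ENNReal, smul_smul,
      ENNReal.inv_mul_cancel two_ne_zero ENNReal.ofNat_ne_top, one_smul]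
  · rw [Measure.map_smul, Measure.map_add _ _ hS, Measure.map_smul, Measure.map_add _ _ hf,
      hμ.2, hν.2, ← two_smul ENNReal, smul_smul,
      ENNReal.inv_mul_cancel two_ne_zero ENNReal.ofNat_ne_top, one_smul]

theorem msupp_half_add (μ ν : Measure ℝ) :
    msupp ((2⁻¹ : ENNReal) • (μ + ν)) = msupp μ ∪ msupp ν := by
  ext x
  simp only [msupp, mem_union, mem_ofPred_eq, Measure.smul_apply, Measure.add_apply, smul_eq_mul,
    pos_iff_ne_zero, ne_eq, mul_eq_zero, add_eq_zero, ENNReal.inv_eq_zero, ENNReal.ofNat_ne_top,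
    false_or]
  constructor
  · intro h
    by_contra! hcon
    obtain ⟨⟨U, hU, hU0⟩, V, hV, hV0⟩ := hcon
    exact h _ (Filter.inter_mem hU hV)
      ⟨measure_mono_null inter_subset_left hU0, measure_mono_null inter_subset_right hV0⟩
  · rintro (h | h) U hU ⟨h₁, h₂⟩
    exacts [h U hU h₁, h U hU h₂]

theorem mem_msupp_map_add {μ : Measure ℝ} {d x : ℝ} :
    x ∈ msupp (μ.map (fun y => y + d)) ↔ x - d ∈ msupp μ := by
  have hmap (U : Set ℝ) : μ.map (fun y => y + d) U = μ ((fun y => y + d) ⁻¹' U) :=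
    (MeasurableEquiv.addRight d).map_apply U
  simp only [msupp, mem_ofPred_eq, hmap]
  constructor
  · intro h U hU
    have hc : Filter.Tendsto (fun y : ℝ => y - d) (nhds x) (nhds (x - d)) :=
      (continuous_id.sub continuous_const).tendsto x
    simpa [preimage_preimage] using h _ (hc hU)
  · intro h U hU
    have hc : Filter.Tendsto (fun y : ℝ => y + d) (nhds (x - d)) (nhds x) :=
      (continuous_add_const d).tendsto' _ _ (sub_add_cancel x d)
    exact h _ (hc hU)

theorem msupp_nonempty (μ : Measure ℝ) [IsProbabilityMeasure μ] : (msupp μ).Nonempty :=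
  (Measure.nonempty_support (IsProbabilityMeasure.ne_zero μ)).imp fun x hx =>
    (Measure.mem_support_iff_forall x).1 hx

/-- On the line, the union of a nonempty set of diameter `c` and its translate by `d ≥ 0` has
diameter `c + d`. -/
theorem ediam_union_translate {S S' : Set ℝ} {c d : ℝ} (hS : S.Nonempty) (hc : 0 ≤ c) (hd : 0 ≤ d)
    (hdiam : Metric.ediam S = ENNReal.ofReal c) (hS' : ∀ x, x ∈ S' ↔ x - d ∈ S) :
    Metric.ediam (S ∪ S') = ENNReal.ofReal (c + d) := by
  have hdist : ∀ x ∈ S, ∀ y ∈ S, x - y ≤ c := fun x hx y hy => by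
    have := Metric.edist_le_ediam_of_mem hx hy
    rw [hdiam, edist_dist, ENNReal.ofReal_le_ofReal_iff hc, Real.dist_eq] at this
    exact (le_abs_self _).trans this
  have hle : Metric.ediam (S ∪ S') ≤ ENNReal.ofReal (c + d) := by
    refine Metric.ediam_le fun x hx y hy => ?_
    rw [edist_dist, Real.dist_eq]
    refine ENNReal.ofReal_le_ofReal (abs_le.2 ?_)
    simp only [mem_union, hS'] at hx hy
    rcases hx with hx | hx <;> rcases hy with hy | hy <;>
      constructor <;> linarith [hdist _ hx _ hy, hdist _ hy _ hx]
  refine le_antisymm hle ?_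
  have htop : Metric.ediam (S ∪ S') ≠ ⊤ := ne_top_of_le_ne_top ENNReal.ofReal_ne_top hle
  have hge : ∀ x ∈ S, ∀ y ∈ S, x - y ≤ (Metric.ediam (S ∪ S')).toReal - d := fun x hx y hy => by
    have hx' : x + d ∈ S ∪ S' := Or.inr ((hS' _).2 (by simpa using hx))
    have := Metric.edist_le_ediam_of_mem hx' (Or.inl hy : y ∈ S ∪ S')
    rw [edist_dist, ENNReal.ofReal_le_iff_le_toReal htop, Real.dist_eq] at this
    linarith [le_abs_self (x + d - y)]
  have h0 : 0 ≤ (Metric.ediam (S ∪ S')).toReal - d := by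
    obtain ⟨x, hx⟩ := hS
    simpa using hge x hx x hx
  have hcle : ENNReal.ofReal c ≤ ENNReal.ofReal ((Metric.ediam (S ∪ S')).toReal - d) := by
    rw [← hdiam]
    refine Metric.ediam_le fun x hx y hy => ?_
    rw [edist_dist, Real.dist_eq]
    exact ENNReal.ofReal_le_ofReal (abs_sub_le_iff.2 ⟨hge x hx y hy, hge y hy x hx⟩)
  rw [ENNReal.ofReal_le_ofReal_iff h0] at hcle
  exact ENNReal.ofReal_le_of_le_toReal (by linarith)

theorem stmt_8 (α β c : ℝ) (hβ : β ≠ 0) (hc : 0 ≤ c)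
    (h : ∃ μ : Measure ℝ, IsProbabilityMeasure μ ∧ IsCIUPM (T α β) μ ∧
      EMetric.diam (msupp μ) = ENNReal.ofReal c) :
    ∀ c' : ℝ, c < c' →
      ∃ ν : Measure ℝ, IsProbabilityMeasure ν ∧ IsCIUPM (T α β) ν ∧
        EMetric.diam (msupp ν) = ENNReal.ofReal c' := by
  obtain ⟨μ, hμ, hCI, hdiam⟩ := h
  intro c' hc'
  have hmap : IsProbabilityMeasure (μ.map fun x => x + (c' - c)) :=
    Measure.isProbabilityMeasure_map (by fun_prop)
  refine ⟨(2⁻¹ : ENNReal) • (μ + μ.map fun x => x + (c' - c)), ⟨?_⟩,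
    hCI.half_add (measurable_T α β) (hCI.map_add _), ?_⟩
  · rw [Measure.smul_apply, Measure.add_apply, measure_univ, measure_univ, smul_eq_mul,
      one_add_one_eq_two, ENNReal.inv_mul_cancel two_ne_zero ENNReal.ofNat_ne_top]
  · rw [msupp_half_add]
    have := ediam_union_translate (msupp_nonempty μ) hc (sub_nonneg.2 hc'.le) hdiam
      fun x => mem_msupp_map_add
    rwa [add_sub_cancel] at this
end

section
/- Let α ∈ ℝ and β ≠ 0, and let c ≥ 0. There exists a CIUPM for T_{α,β} whose support has diameter equal to c if and only if c ≥ c_β, where c_β = 1 + 1/|β| − 1/p_β if β is rational (with |β| = p_β/q_β in lowest terms) and c_β = 1 + 1/|β| if β is irrational. -/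
open MeasureTheory Set
open scoped Classical

/-- The threshold constant `c_β`: if `β` is rational with `|β| = p_β/q_β` in lowest terms
then `c_β = 1 + 1/|β| - 1/p_β`; if `β` is irrational then `c_β = 1 + 1/|β|`.
(For a rational `r` with `(r : ℝ) = β`, the numerator of `|r|` is `r.num.natAbs`,
since rationals in Lean are stored in lowest terms.) -/
noncomputable def cbeta (β : ℝ) : ℝ :=
  if h : ∃ r : ℚ, (r : ℝ) = β then 1 + 1 / |β| - 1 / (h.choose.num.natAbs : ℝ)
  else 1 + 1 / |β|

/-- Two finite measures on the circle with the same Fourier coefficients are equal. -/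
theorem AddCircle.measure_ext_of_integral_fourier {P Q : Measure (AddCircle (1 : ℝ))}
    [IsFiniteMeasure P] [IsFiniteMeasure Q]
    (h : ∀ n : ℤ, ∫ x, (fourier n x : ℂ) ∂P = ∫ x, (fourier n x : ℂ) ∂Q) : P = Q := by
  have hInt : ∀ (R : Measure (AddCircle (1 : ℝ))) [IsFiniteMeasure R]
      (f : C(AddCircle (1 : ℝ), ℂ)), Integrable f R := fun R _ f =>
    f.continuous.integrable_of_hasCompactSupport (HasCompactSupport.of_compactSpace f)
  have key : ∀ f ∈ Submodule.span ℂ (range (@fourier (1 : ℝ))),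
      ∫ x, f x ∂P = ∫ x, f x ∂Q := by
    intro f hf
    induction hf using Submodule.span_induction with
    | mem f hf => obtain ⟨n, rfl⟩ := hf; exact h n
    | zero => simp
    | add f g _ _ hf hg =>
      simp only [ContinuousMap.add_apply]
      rw [integral_add (hInt P f) (hInt P g), integral_add (hInt Q f) (hInt Q g), hf, hg]
    | smul a f _ hf =>
      simp only [ContinuousMap.smul_apply]
      rw [integral_smul, integral_smul, hf]
  refine ext_of_forall_mem_subalgebra_integral_eq_of_polish (𝕜 := ℂ)
    (A := (fourierSubalgebra (T := (1 : ℝ))).comap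
      (BoundedContinuousFunction.toContinuousMapStarₐ ℂ)) ?_ ?_
  · intro x y hxy
    obtain ⟨f, ⟨g, hg, rfl⟩, hne⟩ := fourierSubalgebra_separatesPoints (T := (1 : ℝ)) hxy
    exact ⟨g, ⟨g, ⟨BoundedContinuousFunction.mkOfCompact g, hg, rfl⟩, rfl⟩, hne⟩
  · intro g hg
    refine key (g : C(AddCircle (1 : ℝ), ℂ)) ?_
    rw [← fourierSubalgebra_coe]
    exact hg

theorem charFun_map_fract (μ : Measure ℝ) (n : ℤ) :
    charFun (μ.map Int.fract) (2 * Real.pi * n) = charFun μ (2 * Real.pi * n) := by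
  rw [charFun_apply_real, charFun_apply_real,
    integral_map measurable_fract.aemeasurable (by fun_prop)]
  congr 1
  ext x
  rw [Complex.exp_eq_exp_iff_exists_int]
  refine ⟨-(n * ⌊x⌋), ?_⟩
  rw [← Int.self_sub_floor]
  push_cast
  ring

theorem integral_fourier_map_coe (μ : Measure ℝ) (n : ℤ) :
    ∫ x, (fourier n x : ℂ) ∂(μ.map (fun x : ℝ => (x : AddCircle (1 : ℝ)))) =
      charFun μ (2 * Real.pi * n) := by
  rw [charFun_apply_real, integral_map (AddCircle.measurable_mk'.aemeasurable)
    ((map_continuous _).aestronglyMeasurable)]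
  congr 1
  ext x
  rw [fourier_coe_apply]
  congr 1
  push_cast
  ring

theorem map_fract_eq_of_charFun_eq {μ ν : Measure ℝ} [IsFiniteMeasure μ] [IsFiniteMeasure ν]
    (h : ∀ n : ℤ, charFun μ (2 * Real.pi * n) = charFun ν (2 * Real.pi * n)) :
    μ.map Int.fract = ν.map Int.fract := by
  have hcirc : μ.map (fun x : ℝ => (x : AddCircle (1 : ℝ))) =
      ν.map (fun x : ℝ => (x : AddCircle (1 : ℝ))) :=
    AddCircle.measure_ext_of_integral_fourier fun n => by
      rw [integral_fourier_map_coe, integral_fourier_map_coe, h]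
  have hm : Measurable (fun x : ℝ => (x : AddCircle (1 : ℝ))) := AddCircle.measurable_mk'
  have hg : Measurable (fun y : AddCircle (1 : ℝ) =>
      ((AddCircle.measurableEquivIco 1 0 y : Ico (0 : ℝ) (0 + 1)) : ℝ)) :=
    measurable_subtype_coe.comp (AddCircle.measurableEquivIco 1 0).measurable
  have hfr : (Int.fract : ℝ → ℝ) = (fun y : AddCircle (1 : ℝ) =>
      ((AddCircle.measurableEquivIco 1 0 y : Ico (0 : ℝ) (0 + 1)) : ℝ)) ∘
      (fun x : ℝ => (x : AddCircle (1 : ℝ))) := by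
    ext x
    have := AddCircle.coe_equivIco_mk_apply (p := (1 : ℝ)) x
    simp only [div_one, mul_one] at this
    exact this.symm
  rw [hfr, ← Measure.map_map hg hm, ← Measure.map_map hg hm, hcirc]

/-- The uniform probability measure on the unit interval. -/
noncomputable abbrev unif : Measure ℝ := volume.restrict (Ico (0 : ℝ) 1)

instance : IsProbabilityMeasure unif := ⟨by simp⟩

theorem charFun_unif {t : ℝ} (ht : t ≠ 0) :
    charFun unif t = (Complex.exp (t * Complex.I) - 1) / (t * Complex.I) := by
  have h : (t * Complex.I : ℂ) ≠ 0 := by simp [ht]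
  have := integral_exp_mul_complex (a := 0) (b := 1) h
  rw [charFun_apply_real, integral_Ico_eq_integral_Ioc,
    ← intervalIntegral.integral_of_le zero_le_one]
  simp only [Complex.ofReal_one, Complex.ofReal_zero, mul_one, mul_zero, Complex.exp_zero] at this
  rw [← this]
  congr 1
  ext x
  congr 1
  ring

theorem exp_two_pi_int (n : ℤ) : Complex.exp ((2 * Real.pi * n : ℝ) * Complex.I) = 1 := by
  rw [Complex.exp_eq_one_iff]
  exact ⟨n, by push_cast; ring⟩

theorem charFun_unif_two_pi_int {n : ℤ} (hn : n ≠ 0) : charFun unif (2 * Real.pi * n) = 0 := by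
  rw [charFun_unif (by simp [hn, Real.pi_ne_zero]), exp_two_pi_int]
  simp

theorem map_fract_unif : unif.map Int.fract = unif := by
  conv_rhs => rw [← Measure.map_id (μ := unif)]
  refine Measure.map_congr ?_
  filter_upwards [ae_restrict_mem measurableSet_Ico] with x hx
  exact Int.fract_eq_self.2 hx

/-- A probability measure on `ℝ` is uniform modulo `1` iff its characteristic function vanishes
at the nonzero integer multiples of `2π`. -/
theorem map_fract_eq_unif_iff {μ : Measure ℝ} [IsProbabilityMeasure μ] :
    μ.map Int.fract = unif ↔ ∀ n : ℤ, n ≠ 0 → charFun μ (2 * Real.pi * n) = 0 := by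
  constructor
  · intro h n hn
    rw [← charFun_map_fract, h, charFun_unif_two_pi_int hn]
  · intro h
    rw [← map_fract_unif]
    refine map_fract_eq_of_charFun_eq fun n => ?_
    rcases eq_or_ne n 0 with rfl | hn
    · simp
    · rw [h n hn, charFun_unif_two_pi_int hn]

theorem charFun_map_T (μ : Measure ℝ) (α β t : ℝ) :
    charFun (μ.map (T α β)) t = Complex.exp (t * α * Complex.I) * charFun μ (β * t) := by
  rw [charFun_apply_real, charFun_apply_real, ← integral_const_mul,
    integral_map (by unfold T; fun_prop) (by fun_prop)]
  congr 1
  ext x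
  rw [← Complex.exp_add, T]
  congr 1
  push_cast
  ring

theorem isCIUPM_T_iff {α β : ℝ} {μ : Measure ℝ} [IsProbabilityMeasure μ] :
    IsCIUPM (T α β) μ ↔ ∀ n : ℤ, n ≠ 0 →
      charFun μ (2 * Real.pi * n) = 0 ∧ charFun μ (β * (2 * Real.pi * n)) = 0 := by
  have : IsProbabilityMeasure (μ.map (T α β)) :=
    Measure.isProbabilityMeasure_map (by unfold T; fun_prop)
  rw [IsCIUPM, map_fract_eq_unif_iff, map_fract_eq_unif_iff]
  simp only [charFun_map_T, mul_eq_zero, Complex.exp_ne_zero, false_or]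
  exact ⟨fun h n hn => ⟨h.1 n hn, h.2 n hn⟩,
    fun h => ⟨fun n hn => (h n hn).1, fun n hn => (h n hn).2⟩⟩

theorem circleAverage_abs_re {R : ℝ} (hR : 0 < R) :
    Real.circleAverage (fun z : ℂ => |z.re|) 0 R = 2 * R / Real.pi := by
  have hre : ∀ θ : ℝ, |(circleMap 0 R (θ + Real.pi / 2)).re| = R * |Real.sin θ| := by
    intro θ
    rw [circleMap_zero, Complex.re_ofReal_mul, Complex.exp_ofReal_mul_I_re,
      Real.cos_add_pi_div_two, abs_mul, abs_neg, abs_of_pos hR]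
  have hii : ∀ a b : ℝ, IntervalIntegrable (fun θ => |Real.sin θ|) volume a b := fun a b =>
    Real.continuous_sin.abs.intervalIntegrable a b
  have h1 : ∫ θ in (0 : ℝ)..Real.pi, |Real.sin θ| = 2 := by
    rw [show (2 : ℝ) = ∫ θ in (0 : ℝ)..Real.pi, Real.sin θ by rw [integral_sin]; norm_num]
    refine intervalIntegral.integral_congr fun θ hθ => ?_
    rw [uIcc_of_le Real.pi_pos.le] at hθ
    exact abs_of_nonneg (Real.sin_nonneg_of_nonneg_of_le_pi hθ.1 hθ.2)
  have h2 : ∫ θ in Real.pi..2 * Real.pi, |Real.sin θ| = 2 := by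
    have := intervalIntegral.integral_comp_add_right (a := 0) (b := Real.pi)
      (fun θ => |Real.sin θ|) Real.pi
    rw [zero_add, ← two_mul] at this
    rw [← this, ← h1]
    simp [Real.sin_add_pi]
  rw [Real.circleAverage_eq_integral_add (Real.pi / 2)]
  simp only [hre]
  rw [intervalIntegral.integral_const_mul, ← intervalIntegral.integral_add_adjacent_intervals
    (hii 0 Real.pi) (hii Real.pi (2 * Real.pi)), h1, h2, smul_eq_mul]
  field_simp
  norm_num

/-- Jensen's inequality for an entire function of exponential growth `a` in the real direction. -/
theorem sum_log_zeros_le {F : ℂ → ℂ} (hF : Differentiable ℂ F) (h0 : F 0 = 1) {a R : ℝ}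
    (hR : 0 < R) (ha : 0 ≤ a) (hbound : ∀ z, ‖F z‖ ≤ Real.exp (a * |z.re|)) (S : Finset ℂ)
    (hS : ∀ u ∈ S, F u = 0 ∧ ‖u‖ ≤ R) :
    ∑ u ∈ S, Real.log (R * ‖u‖⁻¹) ≤ a * (2 * R / Real.pi) := by
  have hAn : AnalyticOnNhd ℂ F univ := hF.differentiableOn.analyticOnNhd isOpen_univ
  have hAb : AnalyticOnNhd ℂ F (Metric.closedBall 0 |R|) := hAn.mono (subset_univ _)
  have jensen := hAb.circleAverage_log_norm hR.ne' (by rw [h0]; exact one_ne_zero)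
  have havg : Real.circleAverage (fun z => Real.log ‖F z‖) 0 R ≤ a * (2 * R / Real.pi) := by
    rw [← circleAverage_abs_re hR, ← smul_eq_mul, ← Real.circleAverage_fun_smul]
    refine Real.circleAverage_mono ?_ ?_ ?_
    · exact (hAn.mono (subset_univ _)).meromorphicOn.circleIntegrable_log_norm
    · exact ContinuousOn.circleIntegrable' (by fun_prop)
    · intro z _
      rcases eq_or_ne (F z) 0 with h | h
      · simp only [h, norm_zero, Real.log_zero, smul_eq_mul]
        positivity
      · rw [Real.log_le_iff_le_exp (norm_pos_iff.2 h)]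
        exact hbound z
  refine le_trans ?_ havg
  rw [jensen, h0]
  simp only [norm_one, Real.log_one, add_zero, zero_sub, norm_neg]
  set D := MeromorphicOn.divisor F (Metric.closedBall 0 |R|) with hD
  have hnn : ∀ u, 0 ≤ (D u : ℝ) * Real.log (R * ‖u‖⁻¹) := by
    intro u
    by_cases hu : u ∈ Metric.closedBall (0 : ℂ) |R|
    · refine mul_nonneg ?_ ?_
      · exact_mod_cast MeromorphicOn.AnalyticOnNhd.divisor_nonneg hAb u
      · rw [mem_closedBall_zero_iff, abs_of_pos hR] at hu
        rcases eq_or_ne u 0 with rfl | hu0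
        · simp
        · refine Real.log_nonneg ?_
          rw [← div_eq_mul_inv, one_le_div (norm_pos_iff.2 hu0)]
          exact hu
    · rw [Function.locallyFinsuppWithin.apply_eq_zero_of_notMem D hu]
      simp
  have hfin : (Function.support fun u => (D u : ℝ) * Real.log (R * ‖u‖⁻¹)).Finite :=
    (D.finiteSupport (isCompact_closedBall 0 |R|)).subset fun u hu => by
      contrapose! hu
      simp_all
  have hone : ∀ u ∈ S, Real.log (R * ‖u‖⁻¹) ≤ (D u : ℝ) * Real.log (R * ‖u‖⁻¹) := by
    intro u hu
    have hub : u ∈ Metric.closedBall (0 : ℂ) |R| := by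
      rw [mem_closedBall_zero_iff, abs_of_pos hR]; exact (hS u hu).2
    have hu0 : u ≠ 0 := by
      rintro rfl
      exact one_ne_zero (h0.symm.trans (hS 0 hu).1)
    have hlog : 0 ≤ Real.log (R * ‖u‖⁻¹) := by
      refine Real.log_nonneg ?_
      rw [← div_eq_mul_inv, one_le_div (norm_pos_iff.2 hu0)]
      exact (hS u hu).2
    refine le_mul_of_one_le_left hlog ?_
    have hord : analyticOrderAt F u ≠ 0 := by
      rw [(hAn u trivial).analyticOrderAt_ne_zero]
      exact (hS u hu).1
    have htop : analyticOrderAt F u ≠ ⊤ := by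
      intro htop
      rw [analyticOrderAt_eq_top] at htop
      have := hAn.eq_of_eventuallyEq (g := 0) analyticOnNhd_const htop
      exact one_ne_zero (h0.symm.trans (congrFun this 0))
    rw [hD, MeromorphicOn.AnalyticOnNhd.divisor_apply hAb hub]
    obtain ⟨n, hn⟩ := ENat.ne_top_iff_exists.1 htop
    rw [← hn] at hord ⊢
    have hn1 : 1 ≤ n := Nat.one_le_iff_ne_zero.2 (by exact_mod_cast hord)
    simpa using hn1
  calc ∑ u ∈ S, Real.log (R * ‖u‖⁻¹) ≤ ∑ u ∈ S, (D u : ℝ) * Real.log (R * ‖u‖⁻¹) :=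
        Finset.sum_le_sum hone
    _ ≤ ∑ u ∈ S ∪ hfin.toFinset, (D u : ℝ) * Real.log (R * ‖u‖⁻¹) :=
        Finset.sum_le_sum_of_subset_of_nonneg Finset.subset_union_left fun u _ _ => hnn u
    _ = _ := by
        refine (finsum_eq_sum_of_support_subset _ ?_).symm
        intro u hu
        simp only [Finset.coe_union, mem_union]
        exact Or.inr (by simpa using hu)

theorem log_factorial_le {N : ℕ} (hN : 1 ≤ N) :
    Real.log (N.factorial) ≤ N * Real.log N - N + Real.log N + 1 := by
  induction N, hN using Nat.le_induction with
  | base => simp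
  | succ N hN ih =>
    have hN' : (0 : ℝ) < N := by exact_mod_cast hN
    have key := Real.one_sub_inv_le_log_of_pos (show (0 : ℝ) < (N + 1) / N by positivity)
    rw [Real.log_div (by positivity) hN'.ne'] at key
    have h2 : 1 - ((N + 1 : ℝ) / N)⁻¹ = 1 / (N + 1) := by
      field_simp
      ring
    rw [h2, div_le_iff₀ (by positivity)] at key
    rw [Nat.factorial_succ]
    push_cast
    rw [Real.log_mul (by positivity) (by positivity)]
    nlinarith

theorem le_log_factorial (N : ℕ) : N * Real.log N - N ≤ Real.log (N.factorial) := by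
  rcases Nat.eq_zero_or_pos N with rfl | hN
  · simp
  have hN' : (0 : ℝ) < N := by exact_mod_cast hN
  have h := Real.pow_div_factorial_le_exp (N : ℝ) hN'.le N
  have h2 := Real.log_le_log (by positivity) h
  rw [Real.log_exp, Real.log_div (by positivity) (by positivity), Real.log_pow] at h2
  linarith

theorem sum_log_div_eq {x : ℝ} (hx : 0 < x) (N : ℕ) :
    ∑ n ∈ Finset.Icc 1 N, Real.log (x / n) = N * Real.log x - Real.log N.factorial := by
  induction N with
  | zero => simp
  | succ N ih =>
    rw [Finset.sum_Icc_succ_top (by omega), ih, Nat.factorial_succ]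
    push_cast
    rw [Real.log_div hx.ne' (by positivity), Real.log_mul (by positivity) (by positivity)]
    ring

theorem le_sum_log_div {x : ℝ} (hx : 1 ≤ x) :
    x - Real.log x - 2 ≤ ∑ n ∈ Finset.Icc 1 ⌊x⌋₊, Real.log (x / n) := by
  have hN : 1 ≤ ⌊x⌋₊ := (Nat.one_le_floor_iff x).2 hx
  have hN' : (0 : ℝ) < (⌊x⌋₊ : ℝ) := by exact_mod_cast hN
  have hle : (⌊x⌋₊ : ℝ) ≤ x := Nat.floor_le (by linarith)
  have hlt : x < ⌊x⌋₊ + 1 := Nat.lt_floor_add_one x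
  have hlog := Real.log_le_log hN' hle
  have hf := log_factorial_le hN
  rw [sum_log_div_eq (by linarith)]
  nlinarith

theorem sum_log_div_le {x : ℝ} (hx : 0 < x) :
    ∑ n ∈ Finset.Icc 1 ⌊x⌋₊, Real.log (x / n) ≤ x := by
  rw [sum_log_div_eq hx]
  rcases Nat.eq_zero_or_pos ⌊x⌋₊ with h | hN
  · rw [h]; simpa using hx.le
  have hN' : (0 : ℝ) < (⌊x⌋₊ : ℝ) := by exact_mod_cast hN
  have hf := le_log_factorial ⌊x⌋₊
  have key := Real.log_le_sub_one_of_pos (show 0 < x / ⌊x⌋₊ by positivity)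
  rw [Real.log_div hx.ne' hN'.ne'] at key
  have := mul_le_mul_of_nonneg_left key hN'.le
  have h3 : (⌊x⌋₊ : ℝ) * (x / ⌊x⌋₊ - 1) = x - ⌊x⌋₊ := by field_simp
  linarith

/-- The positive multiples of `d` that are at most `r`. -/
noncomputable def posMultiples (d r : ℝ) : Finset ℝ :=
  (Finset.Icc 1 ⌊r / d⌋₊).image fun n : ℕ => n * d

theorem mem_posMultiples {d r t : ℝ} (hd : 0 < d) (hr : 0 < r) :
    t ∈ posMultiples d r ↔ (∃ n : ℕ, 0 < n ∧ (n : ℝ) * d = t) ∧ t ≤ r := by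
  simp only [posMultiples, Finset.mem_image, Finset.mem_Icc]
  constructor
  · rintro ⟨n, ⟨h1, h2⟩, rfl⟩
    refine ⟨⟨n, h1, rfl⟩, ?_⟩
    rw [Nat.le_floor_iff (by positivity), le_div_iff₀ hd] at h2
    exact h2
  · rintro ⟨⟨n, hn, rfl⟩, h⟩
    refine ⟨n, ⟨hn, ?_⟩, rfl⟩
    rwa [Nat.le_floor_iff (by positivity), le_div_iff₀ hd]

theorem sum_posMultiples {d r : ℝ} (hd : 0 < d) :
    ∑ t ∈ posMultiples d r, Real.log (r / t) =
      ∑ n ∈ Finset.Icc 1 ⌊r / d⌋₊, Real.log (r / d / n) := by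
  rw [posMultiples, Finset.sum_image]
  · refine Finset.sum_congr rfl fun n _ => ?_
    rw [div_div, mul_comm]
  · intro m _ n _ h
    exact_mod_cast mul_right_cancel₀ hd.ne' h

/-- If the characteristic function of a probability measure carried by an interval of length `c`
vanishes at `± 2πt` for all `t` in a finite set of positive numbers at most `r`, then
Jensen's formula bounds the logarithmic counting function of this set. -/
theorem sum_log_div_le_of_charFun_eq_zero {μ : Measure ℝ} [IsProbabilityMeasure μ] {l c r : ℝ}
    (hc : 0 ≤ c) (hsupp : ∀ᵐ x ∂μ, x ∈ Icc l (l + c)) (hr : 0 < r) (P : Finset ℝ)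
    (hpos : ∀ t ∈ P, 0 < t ∧ t ≤ r)
    (hzero : ∀ t ∈ P, charFun μ (2 * Real.pi * t) = 0 ∧ charFun μ (2 * Real.pi * -t) = 0) :
    ∑ t ∈ P, Real.log (r / t) ≤ c * r := by
  have hpi := Real.pi_pos
  set X : ℝ → ℝ := T (-(l + c / 2)) 1 with hX
  have hXm : Measurable X := by rw [hX]; unfold T; fun_prop
  have hXb : ∀ᵐ x ∂μ, |X x| ≤ c / 2 := by
    filter_upwards [hsupp] with x hx
    rw [hX, T, abs_le]
    constructor <;> linarith [hx.1, hx.2]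
  have hexp : ∀ (z : ℂ), ∀ᵐ x ∂μ, ‖Complex.exp (z * X x)‖ ≤ Real.exp (c / 2 * |z.re|) := by
    intro z
    filter_upwards [hXb] with x hx
    rw [Complex.norm_exp, Complex.re_mul_ofReal]
    refine Real.exp_le_exp.2 ((le_abs_self _).trans ?_)
    rw [abs_mul, mul_comm]
    gcongr
  set F : ℂ → ℂ := ProbabilityTheory.complexMGF X μ with hF
  have hbound : ∀ z, ‖F z‖ ≤ Real.exp (c / 2 * |z.re|) := by
    intro z
    have := norm_integral_le_of_norm_le_const (hexp z)
    simpa [hF, ProbabilityTheory.complexMGF] using this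
  have hset : ProbabilityTheory.integrableExpSet X μ = univ := by
    refine eq_univ_of_forall fun t => ?_
    refine Integrable.of_bound (by fun_prop) (Real.exp (c / 2 * |t|)) ?_
    filter_upwards [hexp t] with x hx
    simpa [Complex.norm_exp, Real.norm_eq_abs] using hx
  have hdiff : Differentiable ℂ F := fun z =>
    (ProbabilityTheory.hasDerivAt_complexMGF (by simp [hset])).differentiableAt
  have h0 : F 0 = 1 := by simp [hF, ProbabilityTheory.complexMGF]
  have hval : ∀ t : ℝ, charFun μ (2 * Real.pi * t) = 0 →
      F ((2 * Real.pi * t : ℝ) * Complex.I) = 0 := by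
    intro t ht
    rw [hF, ProbabilityTheory.complexMGF_mul_I hXm.aemeasurable, hX, charFun_map_T, one_mul, ht,
      mul_zero]
  have hdisj : Disjoint P (P.image fun t => -t) := by
    rw [Finset.disjoint_left]
    intro t ht ht'
    obtain ⟨s, hs, rfl⟩ := Finset.mem_image.1 ht'
    linarith [(hpos _ ht).1, (hpos _ hs).1]
  have hinj : Function.Injective fun t : ℝ => ((2 * Real.pi * t : ℝ) : ℂ) * Complex.I := by
    intro s t hst
    have h1 := mul_right_cancel₀ Complex.I_ne_zero hst
    have h2 : 2 * Real.pi * s = 2 * Real.pi * t := by exact_mod_cast h1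
    exact mul_left_cancel₀ (by positivity) h2
  have hnorm : ∀ t : ℝ, ‖((2 * Real.pi * t : ℝ) : ℂ) * Complex.I‖ = 2 * Real.pi * |t| := by
    intro t
    rw [norm_mul, Complex.norm_I, mul_one, Complex.norm_real, Real.norm_eq_abs, abs_mul,
      abs_of_pos (by positivity : 0 < 2 * Real.pi)]
  have hterm : ∀ t : ℝ, 2 * Real.pi * r * (2 * Real.pi * |t|)⁻¹ = r / |t| := by
    intro t
    rw [mul_inv, div_eq_mul_inv]
    field_simp
  have key := sum_log_zeros_le hdiff h0 (R := 2 * Real.pi * r) (a := c / 2) (by positivity)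
    (by positivity) hbound
    ((P ∪ P.image fun t => -t).image fun t : ℝ => ((2 * Real.pi * t : ℝ) : ℂ) * Complex.I) (by
      intro u hu
      obtain ⟨t, ht, rfl⟩ := Finset.mem_image.1 hu
      rw [hnorm]
      rcases Finset.mem_union.1 ht with ht | ht
      · refine ⟨hval t (hzero t ht).1, ?_⟩
        rw [abs_of_pos (hpos t ht).1]
        have := (hpos t ht).2
        gcongr
      · obtain ⟨s, hs, rfl⟩ := Finset.mem_image.1 ht
        refine ⟨hval (-s) (hzero s hs).2, ?_⟩
        rw [abs_neg, abs_of_pos (hpos s hs).1]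
        have := (hpos s hs).2
        gcongr)
  rw [Finset.sum_image hinj.injOn, Finset.sum_union hdisj, Finset.sum_image neg_injective.injOn]
    at key
  simp only [hnorm, hterm, abs_neg] at key
  have hsum : ∑ t ∈ P, Real.log (r / |t|) = ∑ t ∈ P, Real.log (r / t) :=
    Finset.sum_congr rfl fun t ht => by rw [abs_of_pos (hpos t ht).1]
  have hrhs : c / 2 * (2 * (2 * Real.pi * r) / Real.pi) = 2 * (c * r) := by
    field_simp
  rw [hsum, hrhs] at key
  linarith

theorem one_add_sub_le_of_isCIUPM {μ : Measure ℝ} [IsProbabilityMeasure μ] {α β l c δ : ℝ}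
    (hβ : β ≠ 0) (hc : 0 ≤ c) (hμ : IsCIUPM (T α β) μ) (hsupp : ∀ᵐ x ∂μ, x ∈ Icc l (l + c))
    (hδ : ∀ r > 0, ∑ t ∈ posMultiples 1 r ∩ posMultiples |β| r, Real.log (r / t) ≤ δ * r) :
    1 + 1 / |β| - δ ≤ c := by
  have hb : 0 < |β| := abs_pos.2 hβ
  rw [isCIUPM_T_iff] at hμ
  have key : ∀ r : ℝ, 1 ≤ r → |β| ≤ r →
      (1 + 1 / |β| - δ - c) * r ≤ 2 * Real.log r - Real.log |β| + 4 := by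
    intro r h1 h2
    have hr : 0 < r := by linarith
    have h := sum_log_div_le_of_charFun_eq_zero hc hsupp hr
      (posMultiples 1 r ∪ posMultiples |β| r) (by
        intro t ht
        rcases Finset.mem_union.1 ht with ht | ht
        · obtain ⟨⟨n, hn, rfl⟩, htr⟩ := (mem_posMultiples one_pos hr).1 ht
          exact ⟨by positivity, htr⟩
        · obtain ⟨⟨n, hn, rfl⟩, htr⟩ := (mem_posMultiples hb hr).1 ht
          exact ⟨by positivity, htr⟩) (by
        intro t ht
        rcases Finset.mem_union.1 ht with ht | ht
        · obtain ⟨⟨n, hn, rfl⟩, htr⟩ := (mem_posMultiples one_pos hr).1 ht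
          have e1 := (hμ n (by exact_mod_cast hn.ne')).1
          have e2 := (hμ (-n) (by simpa using hn.ne')).1
          push_cast at e1 e2
          simpa using And.intro e1 e2
        · obtain ⟨⟨n, hn, rfl⟩, htr⟩ := (mem_posMultiples hb hr).1 ht
          have e1 := (hμ n (by exact_mod_cast hn.ne')).2
          have e2 := (hμ (-n) (by simpa using hn.ne')).2
          push_cast at e1 e2
          rcases abs_choice β with hs | hs
          · rw [hs]
            exact ⟨by rw [← e1]; congr 1; ring, by rw [← e2]; congr 1; ring⟩
          · rw [hs]
            exact ⟨by rw [← e2]; congr 1; ring, by rw [← e1]; congr 1; ring⟩)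
    have hui := Finset.sum_union_inter (s₁ := posMultiples 1 r) (s₂ := posMultiples |β| r)
      (f := fun t => Real.log (r / t))
    rw [sum_posMultiples one_pos, sum_posMultiples hb] at hui
    have hi := hδ r hr
    have l1 := le_sum_log_div (x := r / 1) (by simpa using h1)
    have l2 := le_sum_log_div (x := r / |β|) (by rwa [one_le_div hb])
    rw [div_one] at l1
    rw [Real.log_div hr.ne' hb.ne'] at l2
    rw [div_one] at hui
    have : (1 + 1 / |β| - δ - c) * r = r + r / |β| - δ * r - c * r := by ring
    linarith
  by_contra! hlt
  set D := 1 + 1 / |β| - δ - c with hD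
  have hDpos : 0 < D := by linarith
  have hlog : ∀ᶠ r : ℝ in Filter.atTop, ‖Real.log r‖ ≤ D / 4 * ‖r‖ :=
    Real.isLittleO_log_id_atTop.def (by positivity)
  obtain ⟨r, hr, h1, h2, h3⟩ := (hlog.and ((Filter.eventually_ge_atTop 1).and
    ((Filter.eventually_ge_atTop |β|).and
      (Filter.eventually_gt_atTop (2 / D * (4 - Real.log |β|)))))).exists
  have hk := key r h1 h2
  rw [Real.norm_of_nonneg (by linarith : (0 : ℝ) ≤ r)] at hr
  have hr' := (le_abs_self _).trans hr
  rw [div_mul_eq_mul_div, div_lt_iff₀ hDpos] at h3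
  nlinarith

theorem msupp_eq_support (μ : Measure ℝ) : msupp μ = μ.support := by
  ext x
  exact (Measure.mem_support_iff_forall x).symm

theorem exists_ae_mem_Icc_of_diam_msupp {μ : Measure ℝ} [IsProbabilityMeasure μ] {c : ℝ}
    (hc : 0 ≤ c) (h : Metric.ediam (msupp μ) = ENNReal.ofReal c) :
    ∃ l, ∀ᵐ x ∂μ, x ∈ Icc l (l + c) := by
  have hdist : ∀ x ∈ msupp μ, ∀ y ∈ msupp μ, x - y ≤ c := by
    intro x hx y hy
    have h1 := Metric.edist_le_ediam_of_mem hx hy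
    rw [h, edist_dist, ENNReal.ofReal_le_ofReal_iff hc, Real.dist_eq] at h1
    exact (le_abs_self _).trans h1
  have hne : (msupp μ).Nonempty := by
    rw [msupp_eq_support]
    exact Measure.nonempty_support (IsProbabilityMeasure.ne_zero μ)
  obtain ⟨x₀, hx₀⟩ := hne
  have hbdd : BddBelow (msupp μ) := ⟨x₀ - c, fun y hy => by linarith [hdist x₀ hx₀ y hy]⟩
  refine ⟨sInf (msupp μ), ?_⟩
  have hae : ∀ᵐ x ∂μ, x ∈ msupp μ := by
    rw [msupp_eq_support]
    exact Measure.support_mem_ae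
  filter_upwards [hae] with x hx
  refine ⟨csInf_le hbdd hx, ?_⟩
  have : x - c ≤ sInf (msupp μ) :=
    le_csInf ⟨x₀, hx₀⟩ fun y hy => by linarith [hdist x hx y hy]
  linarith

/-- The measure `ν` is carried by `[0, e]`, and by no smaller closed interval. -/
structure HasExtent (ν : Measure ℝ) (e : ℝ) : Prop where
  ae_mem : ∀ᵐ x ∂ν, x ∈ Icc 0 e
  left_pos : ∀ ε > 0, 0 < ν (Iio ε)
  right_pos : ∀ ε > 0, 0 < ν (Ioi (e - ε))

theorem HasExtent.diam_msupp {ν : Measure ℝ} {e : ℝ} (h : HasExtent ν e) (he : 0 ≤ e) :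
    Metric.ediam (msupp ν) = ENNReal.ofReal e := by
  have hpos : ∀ s t : Set ℝ, 0 < ν s → s ∩ Icc 0 e ⊆ t → 0 < ν t := by
    intro s t hs hst
    refine hs.trans_le (measure_mono_ae ?_)
    filter_upwards [h.ae_mem] with x hx hxs
    exact hst ⟨hxs, hx⟩
  have h0 : (0 : ℝ) ∈ msupp ν := by
    intro U hU
    obtain ⟨ε, hε, hsub⟩ := Metric.mem_nhds_iff.1 hU
    refine hpos _ _ (h.left_pos ε hε) fun x hx => hsub ?_
    rw [Metric.mem_ball, Real.dist_eq, sub_zero, abs_of_nonneg hx.2.1]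
    exact hx.1
  have h1 : e ∈ msupp ν := by
    intro U hU
    obtain ⟨ε, hε, hsub⟩ := Metric.mem_nhds_iff.1 hU
    refine hpos _ _ (h.right_pos ε hε) fun x hx => hsub ?_
    have hx1 : e - ε < x := hx.1
    rw [Metric.mem_ball, Real.dist_eq, abs_sub_lt_iff]
    constructor <;> linarith [hx.2.2]
  have hsub : msupp ν ⊆ Icc 0 e := by
    rw [msupp_eq_support]
    exact Measure.support_subset_of_isClosed isClosed_Icc h.ae_mem
  refine le_antisymm ?_ ?_
  · refine (Metric.ediam_mono hsub).trans ?_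
    rw [Real.ediam_Icc, sub_zero]
  · refine le_trans ?_ (Metric.edist_le_ediam_of_mem h1 h0)
    rw [edist_dist, Real.dist_eq, sub_zero, abs_of_nonneg he]

theorem HasExtent.conv {ν₁ ν₂ : Measure ℝ} [IsProbabilityMeasure ν₁] [IsProbabilityMeasure ν₂]
    {e₁ e₂ : ℝ} (h₁ : HasExtent ν₁ e₁) (h₂ : HasExtent ν₂ e₂) :
    HasExtent (ν₁.conv ν₂) (e₁ + e₂) where
  ae_mem := by
    refine (ae_map_iff (p := (· ∈ Icc 0 (e₁ + e₂))) (by fun_prop) measurableSet_Icc).2 ?_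
    filter_upwards [Measure.quasiMeasurePreserving_fst.ae h₁.ae_mem,
      Measure.quasiMeasurePreserving_snd.ae h₂.ae_mem] with x hx hy
    exact ⟨add_nonneg hx.1 hy.1, add_le_add hx.2 hy.2⟩
  left_pos ε hε := by
    rw [Measure.conv, Measure.map_apply (by fun_prop) measurableSet_Iio]
    have hp : 0 < (ν₁.prod ν₂) (Iio (ε / 2) ×ˢ Iio (ε / 2)) := by
      rw [Measure.prod_prod]
      exact ENNReal.mul_pos (h₁.left_pos _ (by positivity)).ne' (h₂.left_pos _ (by positivity)).ne'
    refine hp.trans_le (measure_mono fun x hx => ?_)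
    have hx1 : x.1 < ε / 2 := hx.1
    have hx2 : x.2 < ε / 2 := hx.2
    show x.1 + x.2 < ε
    linarith
  right_pos ε hε := by
    rw [Measure.conv, Measure.map_apply (by fun_prop) measurableSet_Ioi]
    have hp : 0 < (ν₁.prod ν₂) (Ioi (e₁ - ε / 2) ×ˢ Ioi (e₂ - ε / 2)) := by
      rw [Measure.prod_prod]
      exact ENNReal.mul_pos (h₁.right_pos _ (by positivity)).ne'
        (h₂.right_pos _ (by positivity)).ne'
    refine hp.trans_le (measure_mono fun x hx => ?_)
    have hx1 : e₁ - ε / 2 < x.1 := hx.1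
    have hx2 : e₂ - ε / 2 < x.2 := hx.2
    show e₁ + e₂ - ε < x.1 + x.2
    linarith

theorem hasExtent_unif : HasExtent unif 1 where
  ae_mem := by
    filter_upwards [ae_restrict_mem measurableSet_Ico] with x hx
    exact Ico_subset_Icc_self hx
  left_pos ε hε := by
    rw [unif, Measure.restrict_apply measurableSet_Iio]
    have hp : 0 < volume (Ioo (0 : ℝ) (min ε 1)) := by
      rw [Real.volume_Ioo]
      simp [hε]
    refine hp.trans_le (measure_mono fun x hx => ?_)
    exact ⟨hx.2.trans_le (min_le_left _ _), hx.1.le, hx.2.trans_le (min_le_right _ _)⟩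
  right_pos ε hε := by
    rw [unif, Measure.restrict_apply measurableSet_Ioi]
    have hp : 0 < volume (Ioo (max (1 - ε) 0) (1 : ℝ)) := by
      rw [Real.volume_Ioo]
      simp [hε]
    refine hp.trans_le (measure_mono fun x hx => ?_)
    exact ⟨(le_max_left _ _).trans_lt hx.1, ((le_max_right _ _).trans_lt hx.1).le, hx.2⟩

theorem HasExtent.map_mul {ν : Measure ℝ} {e : ℝ} (h : HasExtent ν e) {a : ℝ} (ha : 0 < a) :
    HasExtent (ν.map (a * ·)) (a * e) where
  ae_mem := by
    refine (ae_map_iff (p := (· ∈ Icc 0 (a * e))) (by fun_prop) measurableSet_Icc).2 ?_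
    filter_upwards [h.ae_mem] with x hx
    exact ⟨mul_nonneg ha.le hx.1, mul_le_mul_of_nonneg_left hx.2 ha.le⟩
  left_pos ε hε := by
    rw [Measure.map_apply (by fun_prop) measurableSet_Iio]
    refine (h.left_pos (ε / a) (by positivity)).trans_le (measure_mono fun x hx => ?_)
    have hx1 : x < ε / a := hx
    rw [lt_div_iff₀ ha] at hx1
    show a * x < ε
    linarith
  right_pos ε hε := by
    rw [Measure.map_apply (by fun_prop) measurableSet_Ioi]
    refine (h.right_pos (ε / a) (by positivity)).trans_le (measure_mono fun x hx => ?_)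
    have hx1 : e - x < ε / a := by have : e - ε / a < x := hx; linarith
    rw [lt_div_iff₀ ha] at hx1
    show a * e - ε < a * x
    linarith

/-- The uniform probability measure on the progression `0, s, …, (q - 1) s`. -/
noncomputable def unifProg (q : ℕ) (s : ℝ) : Measure ℝ :=
  (q : ENNReal)⁻¹ • ∑ j ∈ Finset.range q, Measure.dirac (j * s)

theorem isProbabilityMeasure_unifProg {q : ℕ} (hq : q ≠ 0) (s : ℝ) :
    IsProbabilityMeasure (unifProg q s) := ⟨by
  simp [unifProg, ENNReal.inv_mul_cancel (Nat.cast_ne_zero.2 hq) (ENNReal.natCast_ne_top q)]⟩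

theorem unifProg_pos {q j : ℕ} (hj : j < q) {s : ℝ} {A : Set ℝ} (hA : MeasurableSet A)
    (h : (j : ℝ) * s ∈ A) : 0 < unifProg q s A := by
  rw [unifProg, Measure.smul_apply, Measure.finsetSum_apply, smul_eq_mul]
  refine ENNReal.mul_pos (by simp) ?_
  refine ((?_ : (0 : ENNReal) < _).trans_le (Finset.single_le_sum (fun _ _ => zero_le)
    (Finset.mem_range.2 hj))).ne'
  simp [Measure.dirac_apply' _ hA, h]

theorem hasExtent_unifProg {q : ℕ} (hq : q ≠ 0) {s : ℝ} (hs : 0 ≤ s) :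
    HasExtent (unifProg q s) ((q - 1) * s) where
  ae_mem := by
    rw [ae_iff, unifProg, Measure.smul_apply, Measure.finsetSum_apply, Finset.sum_eq_zero,
      smul_zero]
    intro j hj
    have hj' : (j : ℝ) ≤ q - 1 := by
      have : j + 1 ≤ q := Finset.mem_range.1 hj
      have : (j : ℝ) + 1 ≤ q := by exact_mod_cast this
      linarith
    rw [← ae_iff]
    refine (ae_dirac_iff (p := (· ∈ Icc 0 ((q - 1) * s))) measurableSet_Icc).2 ?_
    exact ⟨by positivity, mul_le_mul_of_nonneg_right hj' hs⟩
  left_pos ε hε := unifProg_pos (Nat.pos_of_ne_zero hq) measurableSet_Iio (by simpa using hε)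
  right_pos ε hε := unifProg_pos (Nat.sub_one_lt hq) measurableSet_Ioi (by
    rw [Nat.cast_pred (Nat.pos_of_ne_zero hq), mem_Ioi]
    linarith)

theorem charFun_unifProg_eq_zero {q : ℕ} {s t : ℝ}
    (h1 : Complex.exp ((t * s : ℝ) * Complex.I) ≠ 1)
    (hq : Complex.exp ((t * s : ℝ) * Complex.I) ^ q = 1) : charFun (unifProg q s) t = 0 := by
  have hInt : ∀ j ∈ Finset.range q,
      Integrable (fun x : ℝ => Complex.exp (t * x * Complex.I)) (Measure.dirac ((j : ℝ) * s)) :=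
    fun j _ => integrable_dirac (by simp)
  rw [charFun_apply_real, unifProg, integral_smul_measure, integral_finsetSum_measure hInt]
  simp only [integral_dirac]
  have : ∀ j : ℕ, Complex.exp (t * ((j * s : ℝ) : ℂ) * Complex.I) =
      Complex.exp ((t * s : ℝ) * Complex.I) ^ j := by
    intro j
    rw [← Complex.exp_nat_mul]
    congr 1
    push_cast
    ring
  simp only [this]
  rw [geom_sum_eq h1, hq, sub_self, zero_div, smul_zero]

theorem exists_isCIUPM_of_hasExtent {ν : Measure ℝ} [IsProbabilityMeasure ν] {α β c e : ℝ}
    (hν : HasExtent ν e) (he : 0 ≤ e) (hce : 1 + e ≤ c)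
    (h : ∀ n : ℤ, n ≠ 0 → charFun unif (β * (2 * Real.pi * n)) = 0 ∨
      charFun ν (β * (2 * Real.pi * n)) = 0) :
    ∃ μ : Measure ℝ, IsProbabilityMeasure μ ∧ IsCIUPM (T α β) μ ∧
      Metric.ediam (msupp μ) = ENNReal.ofReal c := by
  have := isProbabilityMeasure_unifProg two_ne_zero (c - (1 + e))
  have hext := hasExtent_unif.conv (hν.conv (hasExtent_unifProg two_ne_zero (sub_nonneg.2 hce)))
  have hc : 1 + (e + (((2 : ℕ) : ℝ) - 1) * (c - (1 + e))) = c := by push_cast; ring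
  rw [hc] at hext
  refine ⟨_, inferInstance, isCIUPM_T_iff.2 fun n hn => ?_, hext.diam_msupp (by linarith)⟩
  simp only [charFun_conv, charFun_unif_two_pi_int hn]
  refine ⟨zero_mul _, ?_⟩
  rcases h n hn with h | h <;> simp [h]

theorem charFun_unif_abs_inv_mul {β : ℝ} (hβ : β ≠ 0) {n : ℤ} (hn : n ≠ 0) :
    charFun (unif.map (|β|⁻¹ * ·)) (β * (2 * Real.pi * n)) = 0 := by
  rw [charFun_map_mul]
  rcases abs_choice β with hs | hs
  · rw [hs, inv_mul_cancel_left₀ hβ, charFun_unif_two_pi_int hn]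
  · rw [hs, inv_neg, neg_mul, inv_mul_cancel_left₀ hβ]
    have := charFun_unif_two_pi_int (neg_ne_zero.2 hn)
    push_cast at this
    rwa [mul_neg] at this

theorem abs_ratCast_eq_div (r : ℚ) : |(r : ℝ)| = (r.num.natAbs : ℝ) / r.den := by
  rw [Rat.cast_def, abs_div, Nat.abs_cast, Nat.cast_natAbs, Int.cast_abs]

theorem charFun_unif_eq_zero_or_unifProg_eq_zero {r : ℚ} (hr : r ≠ 0) {n : ℤ} (hn : n ≠ 0) :
    charFun unif (r * (2 * Real.pi * n)) = 0 ∨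
      charFun (unifProg r.den (1 / r.num.natAbs)) (r * (2 * Real.pi * n)) = 0 := by
  have hden : (r.den : ℝ) ≠ 0 := Nat.cast_ne_zero.2 r.den_nz
  have hnum : (r.num : ℝ) ≠ 0 := Int.cast_ne_zero.2 (Rat.num_ne_zero.2 hr)
  by_cases hdvd : (r.den : ℤ) ∣ n
  · left
    obtain ⟨k, rfl⟩ := hdvd
    have hk : k ≠ 0 := by rintro rfl; simp at hn
    have : (r : ℝ) * (2 * Real.pi * ((r.den * k : ℤ) : ℝ)) = 2 * Real.pi * (r.num * k : ℤ) := by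
      rw [Rat.cast_def]
      push_cast
      field_simp
    rw [this, charFun_unif_two_pi_int (mul_ne_zero (Rat.num_ne_zero.2 hr) hk)]
  · right
    obtain ⟨m, hm, hmn⟩ : ∃ m : ℤ, ¬ (r.den : ℤ) ∣ m ∧
        (r : ℝ) * (2 * Real.pi * n) * (1 / r.num.natAbs) = 2 * Real.pi * m / r.den := by
      rcases Int.natAbs_eq r.num with hs | hs
      · refine ⟨n, hdvd, ?_⟩
        have : (r.num.natAbs : ℝ) = r.num := by rw [← Int.cast_natCast, ← hs]
        rw [this, Rat.cast_def]
        field_simp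
      · refine ⟨-n, by rwa [dvd_neg], ?_⟩
        have : (r.num.natAbs : ℝ) = -r.num := by
          have h2 : (r.num.natAbs : ℤ) = -r.num := by omega
          rw [← Int.cast_natCast, h2, Int.cast_neg]
        rw [this, Rat.cast_def]
        push_cast
        field_simp
    refine charFun_unifProg_eq_zero ?_ ?_
    · rw [hmn, Ne, Complex.exp_eq_one_iff]
      rintro ⟨k, hk⟩
      have hk' : ((2 * Real.pi * m / r.den : ℝ) : ℂ) = ((2 * Real.pi * k : ℝ) : ℂ) := by
        refine mul_right_cancel₀ Complex.I_ne_zero ?_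
        rw [hk]
        push_cast
        ring
      have h2 : 2 * Real.pi * m / r.den = 2 * Real.pi * k := by exact_mod_cast hk'
      rw [div_eq_iff hden, mul_assoc (2 * Real.pi)] at h2
      have h3 := mul_left_cancel₀ (by positivity : (2 * Real.pi : ℝ) ≠ 0) h2
      exact hm ⟨k, by rw [mul_comm]; exact_mod_cast h3⟩
    · rw [hmn, ← Complex.exp_nat_mul, ← exp_two_pi_int m]
      congr 1
      push_cast
      have : (r.den : ℂ) ≠ 0 := Nat.cast_ne_zero.2 r.den_nz
      field_simp

theorem posMultiples_inter_subset (r : ℚ) (hr : r ≠ 0) {x : ℝ} (hx : 0 < x) :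
    posMultiples 1 x ∩ posMultiples |(r : ℝ)| x ⊆ posMultiples r.num.natAbs x := by
  have hp : 0 < r.num.natAbs := Int.natAbs_pos.2 (Rat.num_ne_zero.2 hr)
  have hb : 0 < |(r : ℝ)| := abs_pos.2 (Rat.cast_ne_zero.2 hr)
  have hden : (r.den : ℝ) ≠ 0 := Nat.cast_ne_zero.2 r.den_nz
  intro t ht
  obtain ⟨ht1, ht2⟩ := Finset.mem_inter.1 ht
  obtain ⟨⟨n, hn, rfl⟩, htx⟩ := (mem_posMultiples one_pos hx).1 ht1
  obtain ⟨⟨m, hm, hmn⟩, -⟩ := (mem_posMultiples hb hx).1 ht2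
  rw [mem_posMultiples (by exact_mod_cast hp) hx]
  refine ⟨?_, htx⟩
  rw [abs_ratCast_eq_div, mul_one, mul_div_assoc', div_eq_iff hden] at hmn
  have h1 : m * r.num.natAbs = n * r.den := by exact_mod_cast hmn
  have hdvd : r.num.natAbs ∣ n :=
    r.reduced.dvd_of_dvd_mul_right ⟨m, by rw [← h1, mul_comm]⟩
  obtain ⟨k, rfl⟩ := hdvd
  refine ⟨k, Nat.pos_of_mul_pos_left hn, by push_cast; ring⟩

theorem posMultiples_inter_eq_empty {β : ℝ} (hβ : β ≠ 0) (hirr : ¬ ∃ r : ℚ, (r : ℝ) = β) {x : ℝ}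
    (hx : 0 < x) : posMultiples 1 x ∩ posMultiples |β| x = ∅ := by
  rw [Finset.eq_empty_iff_forall_notMem]
  intro t ht
  obtain ⟨ht1, ht2⟩ := Finset.mem_inter.1 ht
  obtain ⟨⟨n, hn, rfl⟩, -⟩ := (mem_posMultiples one_pos hx).1 ht1
  obtain ⟨⟨m, hm, hmn⟩, -⟩ := (mem_posMultiples (abs_pos.2 hβ) hx).1 ht2
  have hm' : (m : ℝ) ≠ 0 := by positivity
  have habs : |β| = (n : ℝ) / m := by
    rw [eq_div_iff hm']
    linarith
  rcases abs_choice β with hs | hs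
  · exact hirr ⟨n / m, by push_cast; rw [← habs, hs]⟩
  · exact hirr ⟨-(n / m), by push_cast; rw [← habs, hs, neg_neg]⟩

theorem one_add_sub_le_of_isCIUPM_rat {μ : Measure ℝ} [IsProbabilityMeasure μ] {α l c : ℝ} {r : ℚ}
    (hr : r ≠ 0) (hc : 0 ≤ c) (hμ : IsCIUPM (T α r) μ) (hsupp : ∀ᵐ x ∂μ, x ∈ Icc l (l + c)) :
    1 + 1 / |(r : ℝ)| - 1 / r.num.natAbs ≤ c := by
  have hp : (0 : ℝ) < r.num.natAbs := by
    exact_mod_cast Int.natAbs_pos.2 (Rat.num_ne_zero.2 hr)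
  refine one_add_sub_le_of_isCIUPM (Rat.cast_ne_zero.2 hr) hc hμ hsupp fun x hx => ?_
  calc ∑ t ∈ posMultiples 1 x ∩ posMultiples |(r : ℝ)| x, Real.log (x / t)
      ≤ ∑ t ∈ posMultiples r.num.natAbs x, Real.log (x / t) := by
        refine Finset.sum_le_sum_of_subset_of_nonneg (posMultiples_inter_subset r hr hx) ?_
        intro t ht _
        obtain ⟨⟨n, hn, rfl⟩, htx⟩ := (mem_posMultiples hp hx).1 ht
        exact Real.log_nonneg ((one_le_div (by positivity)).2 htx)
    _ ≤ x / r.num.natAbs := by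
        rw [sum_posMultiples hp]
        exact sum_log_div_le (by positivity)
    _ = 1 / r.num.natAbs * x := by ring

theorem exists_isCIUPM_rat {α c : ℝ} {r : ℚ} (hr : r ≠ 0)
    (hc : 1 + 1 / |(r : ℝ)| - 1 / r.num.natAbs ≤ c) :
    ∃ μ : Measure ℝ, IsProbabilityMeasure μ ∧ IsCIUPM (T α r) μ ∧
      Metric.ediam (msupp μ) = ENNReal.ofReal c := by
  have := isProbabilityMeasure_unifProg r.den_nz (1 / r.num.natAbs)
  have hden : (1 : ℝ) ≤ r.den := by exact_mod_cast r.den_pos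
  refine exists_isCIUPM_of_hasExtent (hasExtent_unifProg r.den_nz (by positivity))
    (mul_nonneg (by linarith) (by positivity)) ?_
    fun n hn => charFun_unif_eq_zero_or_unifProg_eq_zero hr hn
  rw [abs_ratCast_eq_div, one_div_div] at hc
  rw [sub_mul, one_mul, mul_one_div]
  linarith

theorem stmt_11 (α β c : ℝ) (hβ : β ≠ 0) (hc : 0 ≤ c) :
    (∃ μ : Measure ℝ, IsProbabilityMeasure μ ∧ IsCIUPM (T α β) μ ∧
      EMetric.diam (msupp μ) = ENNReal.ofReal c) ↔ cbeta β ≤ c := by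
  rw [cbeta]
  split_ifs with h
  · have hspec := h.choose_spec
    generalize h.choose = r at hspec ⊢
    subst hspec
    have hr : r ≠ 0 := Rat.cast_ne_zero.1 hβ
    refine ⟨?_, exists_isCIUPM_rat hr⟩
    rintro ⟨μ, _, hμ, hdiam⟩
    obtain ⟨l, hl⟩ := exists_ae_mem_Icc_of_diam_msupp hc hdiam
    exact one_add_sub_le_of_isCIUPM_rat hr hc hμ hl
  · constructor
    · rintro ⟨μ, _, hμ, hdiam⟩
      obtain ⟨l, hl⟩ := exists_ae_mem_Icc_of_diam_msupp hc hdiam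
      have := one_add_sub_le_of_isCIUPM (δ := 0) hβ hc hμ hl fun x hx => by
        rw [posMultiples_inter_eq_empty hβ h hx]
        simp
      linarith
    · intro hle
      have hb : 0 < |β|⁻¹ := inv_pos.2 (abs_pos.2 hβ)
      have : IsProbabilityMeasure (unif.map (|β|⁻¹ * ·)) :=
        Measure.isProbabilityMeasure_map (by fun_prop)
      refine exists_isCIUPM_of_hasExtent (hasExtent_unif.map_mul hb) (by positivity) ?_
        fun n hn => Or.inr (charFun_unif_abs_inv_mul hβ hn)
      rwa [mul_one, ← one_div]
end

section
/- Let β ≥ 1 be a real number and α ∈ ℝ. The Borel probability measure μ on ℝ with Lebesgue density ρ(t) = βt for t ∈ [0, 1/β), ρ(t) = 1 for t ∈ [1/β, 1), ρ(t) = −βt + 1 + β for t ∈ [1, 1 + 1/β], and ρ(t) = 0 elsewhere, is a CIUPM for T_{α,β}, and its support is the interval [0, 1 + 1/β], of diameter 1 + 1/β. -/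
open MeasureTheory Set

/-- The density `ρ(t) = βt` on `[0,1/β)`, `1` on `[1/β,1)`, `−βt + 1 + β` on
`[1, 1 + 1/β]`, and `0` elsewhere. -/
noncomputable def rho (β : ℝ) : ℝ → ℝ := fun t =>
  if t < 0 then 0
  else if t < 1 / β then β * t
  else if t < 1 then 1
  else if t ≤ 1 + 1 / β then -β * t + 1 + β
  else 0

/-- A one-periodic set has the same volume in every half-open interval of length one. -/
theorem volume_Ioc_inter_fract_preimage (c : ℝ) {B : Set ℝ} (hB : MeasurableSet B) :
    volume (Ioc c (c + 1) ∩ Int.fract ⁻¹' B) = volume (Ico (0 : ℝ) 1 ∩ B) := by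
  have h1 : volume (Int.fract ⁻¹' B ∩ Ioc c (c + 1)) =
      volume (Int.fract ⁻¹' B ∩ Ioc (0 : ℝ) (0 + 1)) := by
    refine (isAddFundamentalDomain_Ioc (zero_lt_one' ℝ) c).measure_set_eq
      (isAddFundamentalDomain_Ioc (zero_lt_one' ℝ) 0) (measurable_fract hB) ?_
    rintro ⟨g, hg⟩
    obtain ⟨n, rfl⟩ := AddSubgroup.mem_zmultiples_iff.1 hg
    ext x
    simp [AddSubgroup.vadd_def]
  have h2 : volume (Ioc (0 : ℝ) 1 ∩ Int.fract ⁻¹' B) =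
      volume (Ico (0 : ℝ) 1 ∩ Int.fract ⁻¹' B) :=
    measure_congr (Ico_ae_eq_Ioc.symm.inter (ae_eq_refl _))
  rw [inter_comm, h1, zero_add, inter_comm, h2]
  congr 1
  ext x
  simp only [mem_inter_iff, mem_preimage, and_congr_right_iff]
  intro hx
  rw [Int.fract_eq_self.2 hx]

theorem volume_Ioc_inter_fract_add_preimage (c : ℝ) {B : Set ℝ} (hB : MeasurableSet B) :
    volume (Ioc (0 : ℝ) 1 ∩ {x | Int.fract (x + c) ∈ B}) = volume (Ico (0 : ℝ) 1 ∩ B) := by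
  rw [← volume_Ioc_inter_fract_preimage c hB,
    ← measure_preimage_add_right volume c (Ioc c (c + 1) ∩ _)]
  congr 1
  ext x
  simp [add_comm c 1]

theorem volume_Ico_inter_fract_add_preimage (c : ℝ) {B : Set ℝ} (hB : MeasurableSet B) :
    volume (Ico (0 : ℝ) 1 ∩ {x | Int.fract (x + c) ∈ B}) = volume (Ico (0 : ℝ) 1 ∩ B) := by
  rw [← volume_Ioc_inter_fract_add_preimage c hB]
  exact measure_congr (Ico_ae_eq_Ioc.inter (ae_eq_refl _))

theorem volume_Ioc_inter_fract_mul_add_preimage {β : ℝ} (hβ : 0 < β) (c : ℝ) {B : Set ℝ}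
    (hB : MeasurableSet B) :
    volume (Ioc (0 : ℝ) (1 / β) ∩ {x | Int.fract (β * x + c) ∈ B}) =
      ENNReal.ofReal (1 / β) * volume (Ico (0 : ℝ) 1 ∩ B) := by
  have h := Real.volume_preimage_mul_left hβ.ne' (Ioc (0 : ℝ) 1 ∩ {x | Int.fract (x + c) ∈ B})
  rw [volume_Ioc_inter_fract_add_preimage c hB, abs_of_pos (inv_pos.2 hβ)] at h
  rw [one_div, ← h]
  congr 1
  ext x
  simp [hβ, ← one_div, le_div_iff₀' hβ]

theorem measurable_rho (β : ℝ) : Measurable (rho β) := by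
  unfold rho
  refine Measurable.ite measurableSet_Iio (by fun_prop) ?_
  refine Measurable.ite measurableSet_Iio (by fun_prop) ?_
  refine Measurable.ite measurableSet_Iio (by fun_prop) ?_
  exact Measurable.ite measurableSet_Iic (by fun_prop) (by fun_prop)

theorem rho_pos {β : ℝ} (hβ : 1 ≤ β) {t : ℝ} (ht : t ∈ Ioo 0 (1 + 1 / β)) : 0 < rho β t := by
  have hβ0 : 0 < β := by linarith
  have h : β * t < β + 1 := by
    have := mul_lt_mul_of_pos_left ht.2 hβ0
    rwa [mul_add, mul_one, mul_one_div_cancel hβ0.ne'] at this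
  have := mul_pos hβ0 ht.1
  unfold rho
  split_ifs <;> linarith [ht.1, ht.2]

theorem rho_eq_zero {β : ℝ} (hβ : 1 ≤ β) {t : ℝ} (ht : t ∉ Icc 0 (1 + 1 / β)) :
    rho β t = 0 := by
  have h1 : 0 < 1 / β := by positivity
  have h2 : 1 / β ≤ 1 := by rw [div_le_one (by linarith)]; exact hβ
  rw [mem_Icc, not_and_or, not_le, not_le] at ht
  unfold rho
  split_ifs <;> rcases ht with ht | ht <;> linarith

/-- The density `rho β` is the convolution of the uniform densities on `[0, 1)` and
`(0, 1/β]`. -/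
theorem ofReal_rho_eq {β : ℝ} (hβ : 1 ≤ β) (t : ℝ) :
    ENNReal.ofReal (rho β t) = ENNReal.ofReal β *
      ∫⁻ u, (Ico (0 : ℝ) 1).indicator 1 u * (Ioc (0 : ℝ) (1 / β)).indicator 1 (t - u) := by
  have hβ0 : 0 < β := by linarith
  have h : ∀ u, (Ico (0 : ℝ) 1).indicator (1 : ℝ → ENNReal) u *
      (Ioc (0 : ℝ) (1 / β)).indicator 1 (t - u) =
      (Ico (max 0 (t - 1 / β)) (min 1 t)).indicator 1 u := by
    intro u
    simp only [indicator_apply, mem_Ico, mem_Ioc, max_le_iff, lt_min_iff, Pi.one_apply]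
    split_ifs <;> first | (simp; done) | (exfalso; grind)
  simp_rw [h]
  rw [lintegral_indicator_one measurableSet_Ico, Real.volume_Ico, ← ENNReal.ofReal_mul hβ0.le]
  have h1 : 0 < 1 / β := by positivity
  have h2 : 1 / β ≤ 1 := by rw [div_le_one (by linarith)]; exact hβ
  have h3 : β * (1 / β) = 1 := mul_one_div_cancel hβ0.ne'
  unfold rho
  generalize 1 / β = b at *
  split_ifs with c1 c2 c3 c4
  · rw [min_eq_right (by linarith), max_eq_left (by linarith), ENNReal.ofReal_zero, eq_comm,
      ENNReal.ofReal_eq_zero]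
    nlinarith
  · rw [min_eq_right (by linarith), max_eq_left (by linarith), sub_zero]
  · rw [min_eq_right (by linarith), max_eq_right (by linarith)]
    congr 1
    linarith
  · rw [min_eq_left (by linarith), max_eq_right (by linarith)]
    congr 1
    linarith
  · rw [min_eq_left (by linarith), max_eq_right (by linarith), ENNReal.ofReal_zero, eq_comm,
      ENNReal.ofReal_eq_zero]
    nlinarith

theorem withDensity_rho_apply {β : ℝ} (hβ : 1 ≤ β) {S : Set ℝ} (hS : MeasurableSet S) :
    volume.withDensity (fun t => ENNReal.ofReal (rho β t)) S = ENNReal.ofReal β *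
      ∫⁻ u in Ico (0 : ℝ) 1, volume (Ioc (0 : ℝ) (1 / β) ∩ {w | w + u ∈ S}) := by
  have hI : Measurable ((Ico (0 : ℝ) 1).indicator (1 : ℝ → ENNReal)) :=
    measurable_one.indicator measurableSet_Ico
  have hJ : Measurable ((Ioc (0 : ℝ) (1 / β)).indicator (1 : ℝ → ENNReal)) :=
    measurable_one.indicator measurableSet_Ioc
  have hS1 : Measurable (S.indicator (1 : ℝ → ENNReal)) := measurable_one.indicator hS
  calc volume.withDensity (fun t => ENNReal.ofReal (rho β t)) S
      = ∫⁻ t, ENNReal.ofReal β * ∫⁻ u, S.indicator 1 t * ((Ico (0 : ℝ) 1).indicator 1 u *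
          (Ioc (0 : ℝ) (1 / β)).indicator 1 (t - u)) := by
        rw [withDensity_apply _ hS, ← lintegral_indicator hS]
        refine lintegral_congr fun t => ?_
        rw [lintegral_const_mul _ (by fun_prop), mul_left_comm, ← ofReal_rho_eq hβ]
        by_cases ht : t ∈ S <;> simp [ht]
    _ = ENNReal.ofReal β * ∫⁻ u, ∫⁻ t, S.indicator 1 t * ((Ico (0 : ℝ) 1).indicator 1 u *
          (Ioc (0 : ℝ) (1 / β)).indicator 1 (t - u)) := by
        rw [lintegral_const_mul' _ _ ENNReal.ofReal_ne_top, lintegral_lintegral_swap]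
        fun_prop
    _ = _ := by
        rw [← lintegral_indicator measurableSet_Ico]
        congr 1
        refine lintegral_congr fun u => ?_
        rw [← lintegral_add_right_eq_self _ u]
        by_cases hu : u ∈ Ico (0 : ℝ) 1
        · rw [indicator_of_mem (s := Ico (0 : ℝ) 1) hu fun u =>
            volume (Ioc (0 : ℝ) (1 / β) ∩ {w | w + u ∈ S})]
          have hm : MeasurableSet {w | w + u ∈ S} := hS.preimage (measurable_add_const u)
          rw [← lintegral_indicator_one (measurableSet_Ioc.inter hm)]
          refine lintegral_congr fun w => ?_
          rw [inter_indicator_one, Pi.mul_apply, indicator_of_mem hu, Pi.one_apply, one_mul,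
            add_sub_cancel_right, mul_comm]
          rfl
        · simp [indicator_of_notMem hu]

theorem withDensity_rho_apply_symm {β : ℝ} (hβ : 1 ≤ β) {S : Set ℝ} (hS : MeasurableSet S) :
    volume.withDensity (fun t => ENNReal.ofReal (rho β t)) S = ENNReal.ofReal β *
      ∫⁻ w in Ioc (0 : ℝ) (1 / β), volume (Ico (0 : ℝ) 1 ∩ {u | u + w ∈ S}) := by
  have key : ∀ (A : Set ℝ) (u : ℝ), MeasurableSet A → volume (A ∩ {w | w + u ∈ S}) =
      ∫⁻ w in A, S.indicator 1 (w + u) := by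
    intro A u hA
    have hm : MeasurableSet {w | w + u ∈ S} := hS.preimage (measurable_add_const u)
    rw [inter_comm, ← Measure.restrict_apply hm, ← lintegral_indicator_one hm]
    rfl
  have hS1 : Measurable (S.indicator (1 : ℝ → ENNReal)) := measurable_one.indicator hS
  rw [withDensity_rho_apply hβ hS]
  simp_rw [key _ _ measurableSet_Ico, key _ _ measurableSet_Ioc]
  rw [lintegral_lintegral_swap (by fun_prop)]
  simp_rw [add_comm]

theorem isCIUPM_withDensity_rho (α : ℝ) {β : ℝ} (hβ : 1 ≤ β) :
    IsCIUPM (T α β) (volume.withDensity (fun t => ENNReal.ofReal (rho β t))) := by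
  have hβ0 : 0 < β := by linarith
  have hone : ENNReal.ofReal β * ENNReal.ofReal (1 / β) = 1 := by
    rw [← ENNReal.ofReal_mul hβ0.le, mul_one_div_cancel hβ0.ne', ENNReal.ofReal_one]
  have hT : Measurable (T α β) := by unfold T; fun_prop
  constructor <;> ext B hB
  · rw [Measure.map_apply measurable_fract hB, Measure.restrict_apply hB,
      withDensity_rho_apply_symm hβ (measurable_fract hB)]
    simp_rw [mem_preimage, volume_Ico_inter_fract_add_preimage _ hB]
    rw [setLIntegral_const, Real.volume_Ioc, sub_zero, mul_left_comm, hone, mul_one, inter_comm]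
  · rw [Measure.map_apply measurable_fract hB, Measure.restrict_apply hB,
      Measure.map_apply hT (measurable_fract hB),
      withDensity_rho_apply hβ (hT (measurable_fract hB))]
    simp_rw [mem_preimage, T, mul_add, add_assoc,
      volume_Ioc_inter_fract_mul_add_preimage hβ0 _ hB]
    rw [setLIntegral_const, Real.volume_Ico, sub_zero, ENNReal.ofReal_one, mul_one,
      ← mul_assoc, hone, one_mul, inter_comm]

theorem msupp_withDensity_rho {β : ℝ} (hβ : 1 ≤ β) :
    msupp (volume.withDensity (fun t => ENNReal.ofReal (rho β t))) = Icc 0 (1 + 1 / β) := by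
  have hm : Measurable fun t => ENNReal.ofReal (rho β t) := (measurable_rho β).ennreal_ofReal
  have hpos : (0 : ℝ) < 1 + 1 / β := by positivity
  ext x
  constructor
  · intro hx
    by_contra hxI
    refine (hx _ (isClosed_Icc.isOpen_compl.mem_nhds hxI)).ne' ?_
    rw [withDensity_apply _ measurableSet_Icc.compl]
    exact setLIntegral_eq_zero measurableSet_Icc.compl
      fun t ht => by simp [rho_eq_zero hβ ht]
  · intro hx U hU
    obtain ⟨V, hVU, hV, hxV⟩ := mem_nhds_iff.1 hU
    rw [← closure_Ioo hpos.ne] at hx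
    have hvol : 0 < volume (V ∩ Ioo 0 (1 + 1 / β)) :=
      (hV.inter isOpen_Ioo).measure_pos _ (mem_closure_iff.1 hx V hV hxV)
    rw [pos_iff_ne_zero]
    intro h0
    refine hvol.ne' (measure_mono_null ?_ ((withDensity_apply_eq_zero hm).1 h0))
    rintro t ⟨htV, ht⟩
    exact ⟨by simpa using rho_pos hβ ht, hVU htV⟩

theorem stmt_13 (α β : ℝ) (hβ : 1 ≤ β)
    (μ : Measure ℝ) (hμ : μ = volume.withDensity (fun t => ENNReal.ofReal (rho β t))) :
    IsProbabilityMeasure μ ∧ IsCIUPM (T α β) μ ∧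
      msupp μ = Icc (0 : ℝ) (1 + 1 / β) ∧
      EMetric.diam (msupp μ) = ENNReal.ofReal (1 + 1 / β) := by
  subst hμ
  have h := isCIUPM_withDensity_rho α hβ
  have hs := msupp_withDensity_rho hβ
  refine ⟨⟨?_⟩, h, hs, ?_⟩
  · have h1 := congrArg (fun ν : Measure ℝ => ν univ) h.1
    simpa [Measure.map_apply measurable_fract MeasurableSet.univ] using h1
  · rw [hs]
    exact (Real.ediam_Icc _ _).trans (by rw [sub_zero])
end

section
/- Let β = p/q ≥ 1 be rational with p, q coprime positive integers, and let α ∈ ℝ. The Borel probability measure μ_β on ℝ with Lebesgue density ρ_β defined by ρ_β(t) = j/q for t ∈ [(j−1)/p, j/p) ∪ [1 + (q−j−1)/p, 1 + (q−j)/p) for each j = 1, …, q−1, ρ_β(t) = 1 for t ∈ [(q−1)/p, 1), and ρ_β(t) = 0 elsewhere, is a CIUPM for T_{α,β}, and its support is the interval [0, 1 + (q−1)/p], of diameter c_β = 1 + 1/β − 1/p. -/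
open MeasureTheory Set

/-- The density of `μ_β` for rational `β = p/q ≥ 1`: it equals `j/q` on
`[(j−1)/p, j/p) ∪ [1 + (q−j−1)/p, 1 + (q−j)/p)` for `j = 1, …, q−1`,
equals `1` on `[(q−1)/p, 1)`, and `0` elsewhere. -/
noncomputable def rhoQ (p q : ℕ) : ℝ → ℝ := fun t =>
  (∑ j ∈ Finset.Icc 1 (q - 1), ((j : ℝ) / q) *
      Set.indicator
        (Set.Ico (((j : ℝ) - 1) / p) ((j : ℝ) / p) ∪
          Set.Ico (1 + ((q : ℝ) - (j : ℝ) - 1) / p) (1 + ((q : ℝ) - (j : ℝ)) / p)) 1 t)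
    + Set.indicator (Set.Ico (((q : ℝ) - 1) / p) 1) 1 t

theorem indicator_Ico_div_eq {p : ℕ} (hp : 0 < p) {a b t : ℝ} {m n : ℤ} (ha : a = m / p)
    (hb : b = n / p) :
    (Ico a b).indicator (1 : ℝ → ℝ) t = if m ≤ ⌊p * t⌋ ∧ ⌊p * t⌋ < n then 1 else 0 := by
  have hp' : (0 : ℝ) < p := by exact_mod_cast hp
  have : t ∈ Ico a b ↔ m ≤ ⌊p * t⌋ ∧ ⌊p * t⌋ < n := by
    rw [mem_Ico, Int.le_floor, Int.floor_lt, ha, hb, div_le_iff₀' hp', lt_div_iff₀' hp']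
  simp [indicator_apply, this]

theorem sum_ite_between {p q : ℕ} (hq : 0 < q) (hqp : q ≤ p) (k : ℤ) :
    (∑ j ∈ Finset.Icc 1 (q - 1), ((j : ℝ) / q) *
        (if k = j - 1 ∨ k = p + q - j - 1 then 1 else 0)) +
      (if (q : ℤ) - 1 ≤ k ∧ k < p then 1 else 0) =
    (q : ℝ)⁻¹ * ∑ i ∈ Finset.range q, if (i : ℤ) ≤ k ∧ k < p + i then 1 else 0 := by
  have hq' : (q : ℝ) ≠ 0 := by positivity
  have left {n : ℕ} (hn : n < q)
      (h : ∀ j, 1 ≤ j → j < q → ((k = j - 1 ∨ k = p + q - j - 1) ↔ j = n)) :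
      (∑ j ∈ Finset.Icc 1 (q - 1), ((j : ℝ) / q) *
        (if k = j - 1 ∨ k = p + q - j - 1 then 1 else 0)) = (q : ℝ)⁻¹ * n := by
    rw [Finset.sum_congr rfl (g := fun j ↦ if j = n then (j : ℝ) / q else 0)]
    · rw [Finset.sum_ite_eq']
      rcases Nat.eq_zero_or_pos n with rfl | hn0
      · simp
      · rw [if_pos (by simp; omega)]; ring
    · intro j hj
      rw [Finset.mem_Icc] at hj
      simp only [h j (by omega) (by omega), mul_ite, mul_one, mul_zero]
  have card {m n : ℕ} (hn : n ≤ q) (h : ∀ i < q, ((i : ℤ) ≤ k ∧ k < p + i) ↔ m ≤ i ∧ i < n) :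
      (∑ i ∈ Finset.range q, if (i : ℤ) ≤ k ∧ k < p + i then (1 : ℝ) else 0) = (n - m : ℕ) := by
    rw [Finset.sum_boole, ← Nat.card_Ico]
    congr 2
    ext i
    simp only [Finset.mem_filter, Finset.mem_range, Finset.mem_Ico]
    constructor
    · rintro ⟨hi, h1⟩; exact (h i hi).1 h1
    · intro hi; exact ⟨by omega, (h i (by omega)).2 hi⟩
  by_cases h1 : k < 0 ∨ p + q - 1 ≤ k
  · rw [left (n := 0) hq (by omega), card (m := 0) (n := 0) (by omega) (by omega),
      if_neg (by omega)]
    simp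
  push Not at h1
  lift k to ℕ using h1.1
  by_cases h2 : k + 1 < q
  · rw [left (n := k + 1) h2 (by omega),
      card (m := 0) (n := k + 1) (by omega) (by omega), if_neg (by omega)]
    simp
  by_cases h3 : k < p
  · rw [left (n := 0) hq (by omega), card (m := 0) (n := q) (by omega) (by omega),
      if_pos (by omega)]
    simp [hq']
  · rw [left (n := p + q - 1 - k) (by omega) (by omega),
      card (m := k - p + 1) (n := q) (by omega) (by omega), if_neg (by omega),
      show q - (k - p + 1) = p + q - 1 - k by omega]
    simp

theorem rhoQ_eq_average {p q : ℕ} (hq : 0 < q) (hqp : q ≤ p) (t : ℝ) :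
    rhoQ p q t = (q : ℝ)⁻¹ *
      ∑ i ∈ Finset.range q, (Ico ((i : ℝ) / p) (i / p + 1)).indicator (1 : ℝ → ℝ) t := by
  have hp : 0 < p := hq.trans_le hqp
  have hp' : (p : ℝ) ≠ 0 := by positivity
  have hind (i : ℕ) : (Ico ((i : ℝ) / p) (i / p + 1)).indicator (1 : ℝ → ℝ) t =
      if (i : ℤ) ≤ ⌊p * t⌋ ∧ ⌊p * t⌋ < p + i then 1 else 0 :=
    indicator_Ico_div_eq hp (by simp) (by push_cast; field_simp; ring)
  simp_rw [hind]
  rw [← sum_ite_between hq hqp, rhoQ]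
  congr 1
  · refine Finset.sum_congr rfl fun j hj ↦ ?_
    rw [Finset.mem_Icc] at hj
    have hdisj : Disjoint (Ico (((j : ℝ) - 1) / p) (j / p))
        (Ico (1 + ((q : ℝ) - j - 1) / p) (1 + ((q : ℝ) - j) / p)) := by
      refine Set.disjoint_left.2 fun x hx hx' ↦ ?_
      have h1 : (j : ℝ) / p ≤ 1 := by
        rw [div_le_one (by positivity)]; exact_mod_cast (by omega : j ≤ p)
      have h2 : (0 : ℝ) ≤ ((q : ℝ) - j - 1) / p := by
        have : ((j + 1 : ℕ) : ℝ) ≤ q := by exact_mod_cast (by omega : j + 1 ≤ q)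
        push_cast at this
        exact div_nonneg (by linarith) (by positivity)
      linarith [hx.2, hx'.1]
    rw [indicator_union_of_disjoint hdisj]
    beta_reduce
    rw [indicator_Ico_div_eq hp (m := j - 1) (n := j) (by simp) (by simp),
      indicator_Ico_div_eq hp (m := p + q - j - 1) (n := p + q - j)
        (by push_cast; field_simp; ring) (by push_cast; field_simp; ring)]
    congr 1
    split_ifs <;> first | omega | simp
  · rw [indicator_Ico_div_eq hp (m := q - 1) (n := p) (by simp) (by simp [hp'])]

theorem withDensity_rhoQ {p q : ℕ} (hq : 0 < q) (hqp : q ≤ p) :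
    volume.withDensity (fun t ↦ ENNReal.ofReal (rhoQ p q t)) =
      (q : ENNReal)⁻¹ •
        ∑ i ∈ Finset.range q, volume.restrict (Ico ((i : ℝ) / p) (i / p + 1)) := by
  have hsum (s : Finset ℕ) (f : ℕ → Set ℝ) (hf : ∀ i, MeasurableSet (f i)) :
      volume.withDensity (∑ i ∈ s, (f i).indicator 1) = ∑ i ∈ s, volume.restrict (f i) := by
    classical
    induction s using Finset.induction_on with
    | empty => simp
    | insert a s ha ih =>
      rw [Finset.sum_insert ha, Finset.sum_insert ha,
        withDensity_add_left (measurable_one.indicator (hf a)), ih,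
        withDensity_indicator_one (hf a)]
  have hmeas : Measurable (∑ i ∈ Finset.range q,
      (Ico ((i : ℝ) / p) (i / p + 1)).indicator (1 : ℝ → ENNReal)) := by
    rw [Finset.sum_fn]
    exact Finset.measurable_sum _ fun i _ ↦ measurable_one.indicator measurableSet_Ico
  rw [← hsum _ _ fun _ ↦ measurableSet_Ico, ← withDensity_smul _ hmeas]
  congr 1
  ext t
  rw [rhoQ_eq_average hq hqp, ENNReal.ofReal_mul (by positivity),
    ENNReal.ofReal_sum_of_nonneg fun i _ ↦ indicator_nonneg (by simp) t,
    ENNReal.ofReal_inv_of_pos (by positivity), ENNReal.ofReal_natCast,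
    Pi.smul_apply, Finset.sum_apply, smul_eq_mul]
  congr 2 with i
  simp only [indicator_apply, Pi.one_apply]
  split_ifs <;> simp

theorem restrict_Ico_eq_sum (p : ℕ) (a : ℝ) (n : ℕ) :
    (volume : Measure ℝ).restrict (Ico (a / p) ((a + n) / p)) =
      ∑ m ∈ Finset.range n, volume.restrict (Ico ((a + m) / p) ((a + m + 1) / p)) := by
  induction n with
  | zero => simp
  | succ n ih =>
    rw [Finset.sum_range_succ, ← ih, ← Measure.restrict_union _ measurableSet_Ico,
      Ico_union_Ico_eq_Ico]
    · push_cast; rw [add_assoc]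
    · gcongr; simp
    · gcongr ?_ / _; simp
    · exact Set.disjoint_left.2 fun x hx hx' ↦ not_lt.2 hx'.1 hx.2

theorem sum_restrict_Ico_swap {p : ℕ} (hp : 0 < p) (q : ℕ) :
    ∑ i ∈ Finset.range q, (volume : Measure ℝ).restrict (Ico ((i : ℝ) / p) (i / p + 1)) =
      ∑ m ∈ Finset.range p, volume.restrict (Ico ((m : ℝ) / p) ((m + q) / p)) := by
  have hp' : (p : ℝ) ≠ 0 := by positivity
  have h (i : ℕ) : (i : ℝ) / p + 1 = (i + p) / p := by field_simp
  simp_rw [h, restrict_Ico_eq_sum]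
  rw [Finset.sum_comm]
  simp_rw [add_comm (Nat.cast _ : ℝ) (Nat.cast _ : ℝ)]

theorem map_fract_restrict_Ico (a : ℝ) :
    ((volume : Measure ℝ).restrict (Ico a (a + 1))).map Int.fract =
      volume.restrict (Ico (0 : ℝ) 1) := by
  have key (a : ℝ) : (volume : Measure ℝ).restrict (Ico a (a + 1)) =
      volume.restrict (Ioc a (a + 1)) := Measure.restrict_congr_set Ico_ae_eq_Ioc
  have h01 : ((volume : Measure ℝ).restrict (Ico 0 1)).map Int.fract =
      volume.restrict (Ico (0 : ℝ) 1) := by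
    conv_rhs => rw [← Measure.map_id (μ := volume.restrict (Ico (0 : ℝ) 1))]
    refine Measure.map_congr ?_
    filter_upwards [ae_restrict_mem measurableSet_Ico] with x hx
    exact Int.fract_eq_self.2 hx
  rw [← h01]
  ext S hS
  have h0 := key 0
  rw [zero_add] at h0
  have hS' : MeasurableSet (Int.fract ⁻¹' S : Set ℝ) := measurable_fract hS
  rw [Measure.map_apply measurable_fract hS, Measure.map_apply measurable_fract hS, key, h0,
    Measure.restrict_apply hS', Measure.restrict_apply hS']
  have := (isAddFundamentalDomain_Ioc one_pos a volume).measure_set_eq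
    (isAddFundamentalDomain_Ioc one_pos (0 : ℝ) volume) hS' ?_
  · simpa using this
  · rintro ⟨g, hg⟩
    obtain ⟨n, rfl⟩ := AddSubgroup.mem_zmultiples_iff.1 hg
    ext x
    simp [AddSubgroup.vadd_def]

theorem map_T_restrict_Ico (α : ℝ) {β : ℝ} (hβ : 0 < β) (a b : ℝ) :
    ((volume : Measure ℝ).restrict (Ico a b)).map (T α β) =
      ENNReal.ofReal β⁻¹ • volume.restrict (Ico (T α β a) (T α β b)) := by
  have hT : Measurable (T α β) := by unfold T; fun_prop
  have hvol : (volume : Measure ℝ).map (T α β) = ENNReal.ofReal β⁻¹ • volume := by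
    rw [show T α β = (· + α) ∘ (β * ·) from rfl,
      ← Measure.map_map (by fun_prop) (by fun_prop), Real.map_volume_mul_left hβ.ne',
      Measure.map_smul, map_add_right_eq_self, abs_of_pos (inv_pos.2 hβ)]
  have hpre : Ico a b = T α β ⁻¹' Ico (T α β a) (T α β b) := by
    ext x
    simp [T, hβ]
  rw [hpre, ← Measure.restrict_map hT measurableSet_Ico, hvol, Measure.restrict_smul]

theorem isCIUPM_average {p q : ℕ} (hp : 0 < p) (hq : 0 < q) (α : ℝ) :
    IsCIUPM (T α (p / q)) ((q : ENNReal)⁻¹ •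
      ∑ i ∈ Finset.range q, volume.restrict (Ico ((i : ℝ) / p) (i / p + 1))) := by
  have hT : Measurable (T α (p / q)) := by unfold T; fun_prop
  have hp0 : (p : ENNReal) ≠ 0 := by simpa using hp.ne'
  have hq0 : (q : ENNReal) ≠ 0 := by simpa using hq.ne'
  have hpr : (0 : ℝ) < p := by exact_mod_cast hp
  have hqr : (0 : ℝ) < q := by exact_mod_cast hq
  constructor
  · rw [Measure.map_smul, Measure.map_finset_sum measurable_fract.aemeasurable]
    simp_rw [map_fract_restrict_Ico]
    rw [Finset.sum_const, Finset.card_range, ← Nat.cast_smul_eq_nsmul ENNReal, smul_smul,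
      ENNReal.inv_mul_cancel hq0 (by simp), one_smul]
  · have hend (m : ℕ) : T α (p / q) ((m + q) / p) = T α (p / q) (m / p) + 1 := by
      simp only [T]; field_simp; ring
    rw [sum_restrict_Ico_swap hp, Measure.map_smul, Measure.map_finset_sum hT.aemeasurable]
    simp_rw [map_T_restrict_Ico α (div_pos hpr hqr), hend]
    rw [Measure.map_smul, Measure.map_finset_sum measurable_fract.aemeasurable]
    simp_rw [Measure.map_smul, map_fract_restrict_Ico]
    rw [Finset.sum_const, Finset.card_range, ← Nat.cast_smul_eq_nsmul ENNReal, smul_smul,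
      smul_smul, inv_div, ENNReal.ofReal_div_of_pos hpr, ENNReal.ofReal_natCast,
      ENNReal.ofReal_natCast, mul_assoc, ENNReal.mul_div_cancel hp0 (by simp),
      ENNReal.inv_mul_cancel hq0 (by simp), one_smul]

theorem msupp_average {p q : ℕ} (hq : 0 < q) (hqp : q ≤ p) :
    msupp ((q : ENNReal)⁻¹ •
      ∑ i ∈ Finset.range q, volume.restrict (Ico ((i : ℝ) / p) (i / p + 1))) =
      Icc (0 : ℝ) (1 + ((q : ℝ) - 1) / p) := by
  have hpr : (0 : ℝ) < p := by exact_mod_cast hq.trans_le hqp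
  have hq1 : ((q - 1 : ℕ) : ℝ) = q - 1 := by simp [Nat.cast_sub (Nat.one_le_of_lt hq)]
  ext x
  constructor
  · intro hx
    by_contra hx'
    refine (hx _ (isClosed_Icc.isOpen_compl.mem_nhds hx')).ne' ?_
    simp only [Measure.smul_apply, Measure.finsetSum_apply, smul_eq_mul]
    rw [Finset.sum_eq_zero, mul_zero]
    intro i hi
    rw [Measure.restrict_apply measurableSet_Icc.compl]
    convert! measure_empty (μ := (volume : Measure ℝ))
    refine Set.disjoint_iff_inter_eq_empty.1 (Set.disjoint_left.2 fun y hy hy' ↦ hy ⟨?_, ?_⟩)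
    · exact le_trans (by positivity) hy'.1
    · have : (i : ℝ) ≤ q - 1 := by
        rw [← hq1]; exact_mod_cast Nat.le_sub_one_of_lt (Finset.mem_range.1 hi)
      have : (i : ℝ) / p ≤ (q - 1) / p := by gcongr
      linarith [hy'.2]
  · rintro ⟨hx0, hx1⟩ U hU
    obtain ⟨i, hi, hxi⟩ : ∃ i < q, x ∈ Icc ((i : ℝ) / p) (i / p + 1) := by
      rcases le_total x 1 with h | h
      · exact ⟨0, hq, by simpa using ⟨hx0, h⟩⟩
      · refine ⟨q - 1, by omega, ?_, ?_⟩
        · refine le_trans ((div_le_one hpr).2 ?_) h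
          exact_mod_cast (by omega : q - 1 ≤ p)
        · rw [hq1]; linarith
    set a := (i : ℝ) / p
    obtain ⟨V, hVU, hV, hxV⟩ := mem_nhds_iff.1 hU
    have hne : (V ∩ Ioo a (a + 1)).Nonempty := by
      rw [← closure_Ioo (by linarith : a ≠ a + 1)] at hxi
      exact mem_closure_iff.1 hxi V hV hxV
    have hpos : 0 < volume.restrict (Ico a (a + 1)) U := by
      calc 0 < volume (V ∩ Ioo a (a + 1)) := (hV.inter isOpen_Ioo).measure_pos _ hne
        _ ≤ volume (V ∩ Ico a (a + 1)) := by gcongr; exact Ioo_subset_Ico_self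
        _ = volume.restrict (Ico a (a + 1)) V := (Measure.restrict_apply hV.measurableSet).symm
        _ ≤ _ := measure_mono hVU
    simp only [Measure.smul_apply, Measure.finsetSum_apply, smul_eq_mul]
    refine ENNReal.mul_pos (by simp) (ne_of_gt (hpos.trans_le ?_))
    exact Finset.single_le_sum
      (f := fun i : ℕ ↦ volume.restrict (Ico ((i : ℝ) / p) (i / p + 1)) U)
      (fun _ _ ↦ zero_le) (Finset.mem_range.2 hi)

theorem IsCIUPM.isProbabilityMeasure {S : ℝ → ℝ} {μ : Measure ℝ} (h : IsCIUPM S μ) :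
    IsProbabilityMeasure μ := by
  constructor
  have := congrArg (· univ) h.1
  simpa [Measure.map_apply measurable_fract] using this

theorem stmt_14 (α : ℝ) (p q : ℕ) (hp : 0 < p) (hq : 0 < q) (hcop : Nat.Coprime p q)
    (β : ℝ) (hβdef : β = (p : ℝ) / q) (hβ : 1 ≤ β)
    (μ : Measure ℝ) (hμ : μ = volume.withDensity (fun t => ENNReal.ofReal (rhoQ p q t))) :
    IsProbabilityMeasure μ ∧ IsCIUPM (T α β) μ ∧
      msupp μ = Icc (0 : ℝ) (1 + ((q : ℝ) - 1) / p) ∧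
      EMetric.diam (msupp μ) = ENNReal.ofReal (1 + 1 / β - 1 / p) := by
  have hqr : (0 : ℝ) < q := by exact_mod_cast hq
  have hqp : q ≤ p := by
    rw [hβdef, one_le_div hqr] at hβ
    exact_mod_cast hβ
  rw [withDensity_rhoQ hq hqp] at hμ
  have hC : IsCIUPM (T α β) μ := by
    rw [hμ, hβdef]
    exact isCIUPM_average hp hq α
  have hsupp : msupp μ = Icc (0 : ℝ) (1 + ((q : ℝ) - 1) / p) := by
    rw [hμ, msupp_average hq hqp]
  refine ⟨hC.isProbabilityMeasure, hC, hsupp, ?_⟩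
  rw [hsupp, hβdef]
  refine (Real.ediam_Icc _ _).trans ?_
  congr 1
  rw [one_div_div]
  ring
end
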